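/- Let R be a connected finitely generated locally finite graded k-algebra that is universally coherent, i.e., there exists d_0 such that for every d ≥ d_0 the family of all homogeneous right ideals of R generated in degrees ≤ d is a coherent family. Then every finitely presented graded right R-module M has a rational Hilbert series: there exist a Laurent polynomial p(z) with integer coefficients and a polynomial q(z) ∈ ℤ[z] with q(0) = 1 such that q(z)·M(z) = p(z). In particular, R(z) itself is rational. -/

import Mathlib

open MulOpposite

namespace NCG

variable (k : Type) [Field k] (R : Type) [Ring R] [Algebra k R]

/-- `𝒜` is a connected grading on the `k`-algebra `R`: the graded pieces multiply
correctly, `R` is their internal direct sum, and the degree-zero piece is `k·1`. -/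
def IsConnAlg (𝒜 : ℕ → Submodule k R) : Prop :=
  (∀ (i j : ℕ), ∀ x ∈ 𝒜 i, ∀ y ∈ 𝒜 j, x * y ∈ 𝒜 (i + j)) ∧
  DirectSum.IsInternal 𝒜 ∧
  𝒜 0 = Submodule.span k {(1 : R)}

/-- `R` is locally finite: every graded piece is finite-dimensional over `k`. -/
def LocFin (𝒜 : ℕ → Submodule k R) : Prop := ∀ i, FiniteDimensional k (𝒜 i)

/-- `R` is a finitely generated `k`-algebra. -/
def FinGenAlg : Prop := ∃ s : Finset R, Algebra.adjoin k (s : Set R) = ⊤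

/-- extension of the grading to `ℤ` (zero in negative degrees). -/
noncomputable def grZ (𝒜 : ℕ → Submodule k R) : ℤ → Submodule k R :=
  fun j => if 0 ≤ j then 𝒜 j.toNat else ⊥

/-- the augmentation ideal `R_{≥1}`, as a right ideal of `R`. -/
def aug (𝒜 : ℕ → Submodule k R) : Submodule Rᵐᵒᵖ R :=
  Submodule.span Rᵐᵒᵖ (⋃ i : ℕ, ⋃ _ : 1 ≤ i, ((𝒜 i : Set R)))

variable (M : Type) [AddCommGroup M] [Module Rᵐᵒᵖ M] [Module k M]

/-- `ℳ` makes `M` a graded right module over the graded algebra `(R, 𝒜)`. -/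
def IsGradedMod (𝒜 : ℕ → Submodule k R) (ℳ : ℤ → Submodule k M) : Prop :=
  (∀ (i : ℕ) (j : ℤ), ∀ r ∈ 𝒜 i, ∀ x ∈ ℳ j, (op r) • x ∈ ℳ (j + i)) ∧
  DirectSum.IsInternal ℳ

/-- the submodule `N` of `M` is generated in degrees at most `dd`. -/
def GenLE (ℳ : ℤ → Submodule k M) (N : Submodule Rᵐᵒᵖ M) (dd : ℤ) : Prop :=
  N ≤ Submodule.span Rᵐᵒᵖ {x : M | x ∈ N ∧ ∃ j ≤ dd, x ∈ ℳ j}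

/-- the submodule `N` is a graded (homogeneous) submodule of `M`. -/
def IsGradedSub (ℳ : ℤ → Submodule k M) (N : Submodule Rᵐᵒᵖ M) : Prop :=
  N ≤ Submodule.span Rᵐᵒᵖ {x : M | x ∈ N ∧ ∃ j : ℤ, x ∈ ℳ j}

/-- the Hilbert series of a submodule `N` of `M`, as its coefficient function. -/
noncomputable def hilb (ℳ : ℤ → Submodule k M) [IsScalarTower k Rᵐᵒᵖ M]
    (N : Submodule Rᵐᵒᵖ M) : ℤ → ℕ :=
  fun j => Module.finrank k ↥(ℳ j ⊓ N.restrictScalars k)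

/-- the Hilbert series of a right ideal of `R`, as its coefficient function. -/
noncomputable def hilbI (𝒜 : ℕ → Submodule k R) (I : Submodule Rᵐᵒᵖ R) : ℕ → ℕ :=
  fun j => Module.finrank k ↥(𝒜 j ⊓ I.restrictScalars k)

/-- the Hilbert series of the algebra `R`, as its coefficient function. -/
noncomputable def hilbA (𝒜 : ℕ → Submodule k R) : ℕ → ℕ :=
  fun j => Module.finrank k ↥(𝒜 j)

/-- `v` is a solution of the homogeneous linear equation `a₁x₁ + ⋯ + aₙxₙ = 0`. -/
def IsSol {n : ℕ} (a : Fin n → M) (v : Fin n → R) : Prop :=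
  ∑ i, op (v i) • a i = 0

/-- `w` is a homogeneous element of degree `j` of the free module `⊕ᵢ R(-dg i)`. -/
def FreeHomog (𝒜 : ℕ → Submodule k R) {n : ℕ} (dg : Fin n → ℤ)
    (w : Fin n → R) (j : ℤ) : Prop :=
  ∀ i, w i ∈ grZ k R 𝒜 (j - dg i)

/-- The module of solutions of the equation with homogeneous coefficients `a` (of
degrees `dg`) is generated in degrees at most `D`: every solution is an `R`-linear
combination of homogeneous solutions of degree at most `D`. -/
def SolGenLE (𝒜 : ℕ → Submodule k R) {n : ℕ} (a : Fin n → M) (dg : Fin n → ℤ)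
    (D : ℤ) : Prop :=
  ∀ v : Fin n → R, IsSol R M a v →
    v ∈ Submodule.span Rᵐᵒᵖ
      {w : Fin n → R | IsSol R M a w ∧ ∃ j ≤ D, FreeHomog k R 𝒜 dg w j}

/-- The module of solutions of the equation with coefficients `a` is generated by the
(finitely many) solutions `h`. -/
def SolSpanBy {n : ℕ} (a : Fin n → M) {m : ℕ} (h : Fin m → (Fin n → R)) : Prop :=
  (∀ j, IsSol R M a (h j)) ∧
  ∀ v : Fin n → R, IsSol R M a v → v ∈ Submodule.span Rᵐᵒᵖ (Set.range h)

/-- `D` witnesses the effective coherence of the graded module `M`. -/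
def WitnessEC (𝒜 : ℕ → Submodule k R) (ℳ : ℤ → Submodule k M) (D : ℕ → ℕ) : Prop :=
  (∀ d, d ≤ D d) ∧
  ∀ (d n : ℕ) (a : Fin n → M) (dg : Fin n → ℤ),
    (∀ i, a i ∈ ℳ (dg i)) → (∀ i, dg i ≤ (d : ℤ)) →
    SolGenLE k R M 𝒜 a dg ((D d : ℕ) : ℤ)

/-- the graded module `M` is effectively coherent. -/
def EffCoh (𝒜 : ℕ → Submodule k R) (ℳ : ℤ → Submodule k M) : Prop :=
  ∃ D : ℕ → ℕ, WitnessEC k R M 𝒜 ℳ D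

/-- the algebra `R` is effectively coherent (as a right module over itself). -/
noncomputable def EffCohAlg (𝒜 : ℕ → Submodule k R) : Prop :=
  EffCoh k R R 𝒜 (grZ k R 𝒜)

/-- `M` is a finitely presented graded right `R`-module. -/
def ModFinPres (𝒜 : ℕ → Submodule k R) (ℳ : ℤ → Submodule k M) : Prop :=
  ∃ (t : ℕ) (b : Fin t → M) (db : Fin t → ℤ),
    (∀ i, b i ∈ ℳ (db i)) ∧ Submodule.span Rᵐᵒᵖ (Set.range b) = ⊤ ∧
    ∃ (m : ℕ) (h : Fin m → (Fin t → R)) (e : Fin m → ℤ),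
      (∀ j, FreeHomog k R 𝒜 db (h j) (e j)) ∧ SolSpanBy R M b h

/-- `R` is a finitely presented algebra: there is an exact sequence
`F₂ → F₁ → R → k_R → 0` of graded right modules with `F₁, F₂` finite graded free. -/
def AlgFinPres (𝒜 : ℕ → Submodule k R) : Prop :=
  ∃ (n : ℕ) (g : Fin n → R) (dg : Fin n → ℕ),
    (∀ i, g i ∈ 𝒜 (dg i)) ∧
    Submodule.span Rᵐᵒᵖ (Set.range g) = aug k R 𝒜 ∧
    ∃ (m : ℕ) (h : Fin m → (Fin n → R)) (e : Fin m → ℤ),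
      (∀ j, FreeHomog k R 𝒜 (fun i => (dg i : ℤ)) (h j) (e j)) ∧
      SolSpanBy R R g h

/-- `R` admits an exact sequence `F₃ → F₂ → F₁ → R → k_R → 0` of graded right modules
with all `Fᵢ` finite graded free (finitely presented with `dim Tor₃ < ∞`). -/
def AlgFinPres3 (𝒜 : ℕ → Submodule k R) : Prop :=
  ∃ (n : ℕ) (g : Fin n → R) (dg : Fin n → ℕ),
    (∀ i, g i ∈ 𝒜 (dg i)) ∧
    Submodule.span Rᵐᵒᵖ (Set.range g) = aug k R 𝒜 ∧
    ∃ (m : ℕ) (h : Fin m → (Fin n → R)) (e : Fin m → ℤ),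
      (∀ j, FreeHomog k R 𝒜 (fun i => (dg i : ℤ)) (h j) (e j)) ∧
      SolSpanBy R R g h ∧
      ∃ (p : ℕ) (u : Fin p → (Fin m → R)) (f : Fin p → ℤ),
        (∀ l, FreeHomog k R 𝒜 e (u l) (f l)) ∧
        SolSpanBy R (Fin n → R) h u

/-- membership in the class `D(n,a,b,c)`: there is an exact sequence
`F₃ → F₂ → F₁ → R → k_R → 0` with `F₁` of rank at most `n` and basis in degrees `≤ a`,
`F₂` with basis in degrees `≤ b` and `F₃` with basis in degrees `≤ c`. -/
def InDClass (𝒜 : ℕ → Submodule k R) (n a b c : ℕ) : Prop :=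
  ∃ (n' : ℕ), n' ≤ n ∧ ∃ (g : Fin n' → R) (dg : Fin n' → ℕ),
    (∀ i, dg i ≤ a) ∧ (∀ i, g i ∈ 𝒜 (dg i)) ∧
    Submodule.span Rᵐᵒᵖ (Set.range g) = aug k R 𝒜 ∧
    ∃ (m : ℕ) (h : Fin m → (Fin n' → R)) (e : Fin m → ℤ),
      (∀ j, e j ≤ (b : ℤ)) ∧
      (∀ j, FreeHomog k R 𝒜 (fun i => (dg i : ℤ)) (h j) (e j)) ∧
      SolSpanBy R R g h ∧
      SolGenLE k R (Fin n' → R) 𝒜 h e (c : ℤ)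

/-- the right ideal `I` has a finite homogeneous generating family in degrees `≤ d`. -/
def FinGenLE (𝒜 : ℕ → Submodule k R) (I : Submodule Rᵐᵒᵖ R) (d : ℕ) : Prop :=
  ∃ (n : ℕ) (x : Fin n → R) (dx : Fin n → ℕ),
    (∀ i, dx i ≤ d) ∧ (∀ i, x i ∈ 𝒜 (dx i)) ∧
    Submodule.span Rᵐᵒᵖ (Set.range x) = I

/-- lexicographic strict order on `ℕ`-indexed coefficient functions: `f <_lex g`. -/
def LexLtN (f g : ℕ → ℕ) : Prop := ∃ q, (∀ i < q, f i = g i) ∧ f q < g q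

/-- lexicographic strict order on `ℤ`-indexed coefficient functions: `f <_lex g`. -/
def LexLtZ (f g : ℤ → ℕ) : Prop := ∃ q, (∀ i < q, f i = g i) ∧ f q < g q

/-- the right annihilator ideal of an element `a : R`. -/
def rAnn (a : R) : Submodule Rᵐᵒᵖ R where
  carrier := {r : R | a * r = 0}
  add_mem' := by
    intro x y hx hy
    simp only [Set.mem_setOf_eq] at *
    rw [mul_add, hx, hy, add_zero]
  zero_mem' := by simp
  smul_mem' := by
    intro c x hx
    simp only [Set.mem_setOf_eq] at *
    rw [← op_unop c, op_smul_eq_mul, ← mul_assoc, hx, zero_mul]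

/-- the colon right ideal `(x : J) = { a ∈ R | x·a ∈ J }`. -/
def colon (x : R) (J : Submodule Rᵐᵒᵖ R) : Submodule Rᵐᵒᵖ R where
  carrier := {a : R | x * a ∈ J}
  add_mem' := by
    intro p q hp hq
    simp only [Set.mem_setOf_eq] at *
    rw [mul_add]; exact J.add_mem hp hq
  zero_mem' := by simp
  smul_mem' := by
    intro c p hp
    simp only [Set.mem_setOf_eq] at *
    rw [← op_unop c, op_smul_eq_mul, ← mul_assoc]
    exact J.smul_mem (op (unop c)) hp

/-- `F` is a coherent family of right ideals of `R`. -/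
def IsCohFam (𝒜 : ℕ → Submodule k R) (F : Set (Submodule Rᵐᵒᵖ R)) : Prop :=
  (∀ I ∈ F, I.FG ∧ IsGradedSub k R R (grZ k R 𝒜) I) ∧
  (⊥ : Submodule Rᵐᵒᵖ R) ∈ F ∧ aug k R 𝒜 ∈ F ∧
  ∀ I ∈ F, I ≠ ⊥ → ∃ J ∈ F, J ≠ I ∧ ∃ x : R, (∃ dx : ℕ, x ∈ 𝒜 dx) ∧ x ∈ I ∧
    I = J ⊔ Submodule.span Rᵐᵒᵖ {x} ∧
    (∀ dI : ℤ, GenLE k R R (grZ k R 𝒜) I dI → GenLE k R R (grZ k R 𝒜) J dI) ∧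
    colon R x J ∈ F

/-- the family `F` of ideals has degree at most `d`. -/
def CohFamDegLE (𝒜 : ℕ → Submodule k R) (F : Set (Submodule Rᵐᵒᵖ R)) (d : ℕ) : Prop :=
  ∀ I ∈ F, GenLE k R R (grZ k R 𝒜) I (d : ℤ)

/-- the right ideal `I` is finitely presented as a graded module. -/
def IdealFinPres (𝒜 : ℕ → Submodule k R) (I : Submodule Rᵐᵒᵖ R) : Prop :=
  ∃ (n : ℕ) (x : Fin n → R) (dx : Fin n → ℕ),
    (∀ i, x i ∈ 𝒜 (dx i)) ∧ Submodule.span Rᵐᵒᵖ (Set.range x) = I ∧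
    ∃ (m : ℕ) (h : Fin m → (Fin n → R)) (e : Fin m → ℤ),
      (∀ j, FreeHomog k R 𝒜 (fun i => (dx i : ℤ)) (h j) (e j)) ∧
      SolSpanBy R R x h

/-- `R` is graded right coherent: every finitely generated homogeneous right ideal
is finitely presented as a graded module. -/
def GradedCoherent (𝒜 : ℕ → Submodule k R) : Prop :=
  ∀ I : Submodule Rᵐᵒᵖ R, I.FG → IsGradedSub k R R (grZ k R 𝒜) I →
    IdealFinPres k R 𝒜 I

/-- a free resolution of the right ideal `I` by finite graded free modules whose
bases at level `i` sit in degrees at most `B i`. -/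
def FreeResBdd (𝒜 : ℕ → Submodule k R) (I : Submodule Rᵐᵒᵖ R) (B : ℕ → ℤ) : Prop :=
  ∃ (r : ℕ → ℕ) (dgs : (i : ℕ) → Fin (r i) → ℤ)
    (g0 : Fin (r 0) → R)
    (g : (i : ℕ) → Fin (r (i + 1)) → (Fin (r i) → R)),
    (∀ l, dgs 0 l ≤ B 0) ∧
    (∀ l, g0 l ∈ grZ k R 𝒜 (dgs 0 l)) ∧
    Submodule.span Rᵐᵒᵖ (Set.range g0) = I ∧
    (∀ (i : ℕ) (l : Fin (r (i + 1))), dgs (i + 1) l ≤ B (i + 1)) ∧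
    (∀ (i : ℕ) (l : Fin (r (i + 1))), FreeHomog k R 𝒜 (dgs i) (g i l) (dgs (i + 1) l)) ∧
    SolSpanBy R R g0 (g 0) ∧
    (∀ i : ℕ, SolSpanBy R (Fin (r i) → R) (g i) (g (i + 1)))

/-- the Artin–Zhang property for a graded module `M`. -/
def ArtinZhang (ℳ : ℤ → Submodule k M) [IsScalarTower k Rᵐᵒᵖ M] : Prop :=
  ∀ h : ℤ → ℕ, ∃ d : ℤ, 0 < d ∧
    (∀ L : Submodule Rᵐᵒᵖ M, L.FG → hilb k R M ℳ L = h → GenLE k R M ℳ L d) ∧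
    (∀ L : Submodule Rᵐᵒᵖ M, GenLE k R M ℳ L d →
      (∀ j ≤ d, hilb k R M ℳ L j = h j) → hilb k R M ℳ L = h)

/-- `M` is effective for series: for each `d`, only finitely many Hilbert series of
submodules generated in degrees `≤ d`. -/
def EffForSeries (ℳ : ℤ → Submodule k M) [IsScalarTower k Rᵐᵒᵖ M] : Prop :=
  ∀ d : ℤ, {h : ℤ → ℕ | ∃ L : Submodule Rᵐᵒᵖ M,
    GenLE k R M ℳ L d ∧ h = hilb k R M ℳ L}.Finite

/-- `M` is effective for generators: the Hilbert series of a finitely generated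
submodule bounds the degrees of its generators. -/
def EffForGen (ℳ : ℤ → Submodule k M) [IsScalarTower k Rᵐᵒᵖ M] : Prop :=
  ∀ h : ℤ → ℕ, ∃ d : ℤ,
    ∀ L : Submodule Rᵐᵒᵖ M, L.FG → hilb k R M ℳ L = h → GenLE k R M ℳ L d

/-- bundled data of a graded `k`-algebra. -/
structure AlgData (k : Type) [Field k] : Type 1 where
  carrier : Type
  [ringStr : Ring carrier]
  [algStr : Algebra k carrier]
  grading : ℕ → Submodule k carrier

attribute [instance] AlgData.ringStr AlgData.algStr

/-- bundled data of a graded right `R`-module. -/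
structure ModData (k R : Type) [Field k] [Ring R] [Algebra k R] : Type 1 where
  carrier : Type
  [acg : AddCommGroup carrier]
  [modR : Module Rᵐᵒᵖ carrier]
  [modk : Module k carrier]
  [tower : IsScalarTower k Rᵐᵒᵖ carrier]
  grading : ℤ → Submodule k carrier

attribute [instance] ModData.acg ModData.modR ModData.modk ModData.tower


section RegularFunctions

variable {k : Type} [Field k] {T : Type} (𝒪 : Subalgebra k (T → k))

/-- a vector valued function all of whose functionals lie in the function algebra -/
def Reg {V : Type} [AddCommGroup V] [Module k V] (w : T → V) : Prop :=
  ∀ l : V →ₗ[k] k, (fun t => l (w t)) ∈ 𝒪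

variable {V : Type} [AddCommGroup V] [Module k V] {E : Type} [AddCommGroup E] [Module k E]

lemma Reg.comp {w : T → E} (hw : Reg 𝒪 w) (f : E →ₗ[k] V) : Reg 𝒪 (fun t => f (w t)) :=
  fun l => hw (l ∘ₗ f)

lemma exists_dual_family {r : Type} [DecidableEq r] {x : r → V}
    (hx : LinearIndependent k x) : 
    ∃ φ : r → (V →ₗ[k] k), ∀ i j, φ i (x j) = if i = j then 1 else 0 := by
  classical
  obtain ⟨g, hg⟩ := LinearMap.exists_leftInverse_of_injective (Finsupp.linearCombination k x)
    (by rw [LinearMap.ker_eq_bot]; exact hx)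
  refine ⟨fun i => Finsupp.lapply i ∘ₗ g, fun i j => ?_⟩
  have := LinearMap.congr_fun hg (Finsupp.single j 1)
  simp at this
  simp [this, Finsupp.single_apply, eq_comm]

/-- linear independence is an open condition -/
lemma open_li {r : Type} [Fintype r] (w : r → T → V) (hw : ∀ i, Reg 𝒪 (w i)) (t0 : T)
    (h0 : LinearIndependent k (fun i => w i t0)) :
    ∃ g ∈ 𝒪, g t0 ≠ 0 ∧ ∀ t, g t ≠ 0 → LinearIndependent k (fun i => w i t) := by
  classical
  obtain ⟨φ, hφ⟩ := exists_dual_family h0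
  let B : Matrix r r 𝒪 := fun i j => ⟨fun t => φ j (w i t), hw i (φ j)⟩
  let ev : T → (𝒪 →+* k) := fun t => (Pi.evalRingHom (fun _ : T => k) t).comp 𝒪.val.toRingHom
  have hev : ∀ t, (B.det : T → k) t = Matrix.det (Matrix.of fun i j => φ j (w i t)) := by
    intro t
    have := (ev t).map_det B
    exact this
  refine ⟨B.det, B.det.2, ?_, ?_⟩
  · rw [hev]
    have : Matrix.of (fun i j => φ j (w i t0)) = 1 := by
      ext i j; rw [Matrix.of_apply, hφ]; simp [Matrix.one_apply, eq_comm]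
    rw [this]; simp
  · intro t ht
    rw [hev] at ht
    have h1 : LinearIndependent k (Matrix.of fun i j => φ j (w i t)).row :=
      Matrix.linearIndependent_rows_of_det_ne_zero ht
    exact LinearIndependent.of_comp (LinearMap.pi φ) h1

/-- extension of kernel elements on the locus of maximal rank -/
lemma ker_extend [FiniteDimensional k E] (M : T → E →ₗ[k] V)
    (hM : ∀ e, Reg 𝒪 (fun t => M t e))
    (Z : Set T) (t0 : T)
    (hr : ∀ t ∈ Z, Module.finrank k (LinearMap.range (M t)) ≤
      Module.finrank k (LinearMap.range (M t0)))
    (w : E) (hw : M t0 w = 0) :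
    ∃ f ∈ 𝒪, f t0 ≠ 0 ∧ ∃ W : T → E, Reg 𝒪 W ∧ W t0 = w ∧
      ∀ t ∈ Z, f t ≠ 0 → M t (W t) = 0 := by
  classical
  let b := Module.finBasis k (LinearMap.range (M t0))
  set r := Fin (Module.finrank k (LinearMap.range (M t0))) with hrdef
  have hb : ∀ i, ∃ e, M t0 e = (b i : V) := fun i => (b i).2
  choose e he using hb
  have hli : LinearIndependent k (fun i => M t0 (e i)) := by
    simp only [he]
    exact b.linearIndependent.map' (Submodule.subtype _) (by simp)
  obtain ⟨φ, hφ⟩ := exists_dual_family hli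
  let B : Matrix r r 𝒪 := fun j i => ⟨fun t => φ j (M t (e i)), hM (e i) (φ j)⟩
  let y : r → 𝒪 := fun j => ⟨fun t => φ j (M t w), hM w (φ j)⟩
  let ev : T → (𝒪 →+* k) := fun t => (Pi.evalRingHom (fun _ : T => k) t).comp 𝒪.val.toRingHom
  have hev : ∀ t, (B.det : T → k) t = Matrix.det (Matrix.of fun j i => φ j (M t (e i))) := by
    intro t
    exact (ev t).map_det B
  let c : r → 𝒪 := B.adjugate.mulVec y
  have hBc : B.mulVec c = B.det • y := by
    simp only [c, Matrix.mulVec_mulVec, Matrix.mul_adjugate, Matrix.smul_mulVec, Matrix.one_mulVec]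
  have hBc' : ∀ t j, ∑ i, φ j (M t (e i)) * (c i : T → k) t = (B.det : T → k) t * φ j (M t w) := by
    intro t j
    have := congrArg (ev t) (congrFun hBc j)
    simp only [Matrix.mulVec, dotProduct, map_sum, map_mul, Pi.smul_apply, smul_eq_mul] at this
    exact this
  have hd0 : (B.det : T → k) t0 = 1 := by
    rw [hev]
    have : Matrix.of (fun j i => φ j (M t0 (e i))) = 1 := by
      ext i j; rw [Matrix.of_apply, hφ]; simp [Matrix.one_apply]
    rw [this]; simp
  have hc0 : ∀ i, (c i : T → k) t0 = 0 := by
    intro i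
    have : ev t0 (c i) = 0 := by
      simp only [c, Matrix.mulVec, dotProduct, map_sum, map_mul]
      refine Finset.sum_eq_zero fun j _ => ?_
      have : ev t0 (y j) = φ j (M t0 w) := rfl
      rw [this, hw]; simp
    exact this
  refine ⟨B.det, B.det.2, by rw [hd0]; simp,
    fun t => (B.det : T → k) t • w - ∑ i, (c i : T → k) t • e i, ?_, ?_, ?_⟩
  · intro l
    have : (fun t => l ((B.det : T → k) t • w - ∑ i, (c i : T → k) t • e i)) =
        ((l w) • (B.det : T → k) - ∑ i, (l (e i)) • (c i : T → k)) := by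
      ext t
      simp [mul_comm]
    rw [this]
    exact 𝒪.sub_mem (𝒪.smul_mem B.det.2 _) (𝒪.sum_mem fun i _ => 𝒪.smul_mem (c i).2 _)
  · simp [hd0, hc0]
  · intro t ht hf
    rw [hev] at hf
    have h1 : LinearIndependent k (Matrix.of fun j i => φ j (M t (e i))).col :=
      Matrix.linearIndependent_cols_of_det_ne_zero hf
    have h2 : LinearIndependent k (fun i => M t (e i)) :=
      LinearIndependent.of_comp (LinearMap.pi φ) h1
    have h3 : Submodule.span k (Set.range fun i => M t (e i)) = LinearMap.range (M t) := by
      refine Submodule.eq_of_le_of_finrank_le ?_ ?_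
      · rw [Submodule.span_le]; rintro _ ⟨i, rfl⟩; exact ⟨_, rfl⟩
      · rw [finrank_span_eq_card h2]
        simpa [r] using hr t ht
    set z := (B.det : T → k) t • w - ∑ i, (c i : T → k) t • e i with hz
    have h4 : M t z ∈ Submodule.span k (Set.range fun i => M t (e i)) := by
      rw [h3]; exact ⟨_, rfl⟩
    obtain ⟨a, ha⟩ := (Submodule.mem_span_range_iff_exists_fun k).1 h4
    have h5 : ∀ j, φ j (M t z) = 0 := by
      intro j
      have := hBc' t j
      simp only [hz, map_sub, map_smul, map_sum, smul_eq_mul, ← this]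
      rw [sub_eq_zero]
      exact Finset.sum_congr rfl fun i _ => mul_comm _ _
    have h6 : ∑ i, a i • (Matrix.of fun j i => φ j (M t (e i))).col i = 0 := by
      ext j
      have := h5 j
      rw [← ha] at this
      simpa [Matrix.col] using this
    have h7 := Fintype.linearIndependent_iff.1 h1 a h6
    rw [← ha]
    simp [h7]

lemma finrank_map_add {U V : Type} [AddCommGroup U] [Module k U] [AddCommGroup V] [Module k V]
    (f : U →ₗ[k] V) (S : Submodule k U) [FiniteDimensional k S] :
    Module.finrank k (S.map f) + Module.finrank k ↥(S ⊓ LinearMap.ker f) = Module.finrank k S := by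
  have := LinearMap.finrank_range_add_finrank_ker (f.domRestrict S)
  rw [LinearMap.range_domRestrict] at this
  rw [← this]
  congr 1
  rw [LinearMap.ker_domRestrict, ← Submodule.map_comap_subtype]
  exact (Submodule.equivMapOfInjective _ (Submodule.subtype_injective S) _).finrank_eq.symm

end RegularFunctions

section GradedBasics

variable {k : Type} [Field k] {R : Type} [Ring R] [Algebra k R]

/-- right ideal generated by a family -/
def idl {ι : Type} (v : ι → R) : Submodule Rᵐᵒᵖ R := Submodule.span Rᵐᵒᵖ (Set.range v)

lemma mem_idl {ι : Type} [Fintype ι] (v : ι → R) (r : R) :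
    r ∈ idl v ↔ ∃ a : ι → R, r = ∑ i, v i * a i := by
  unfold idl
  rw [Submodule.mem_span_range_iff_exists_fun]
  constructor
  · rintro ⟨c, hc⟩
    exact ⟨fun i => unop (c i), by rw [← hc]; rfl⟩
  · rintro ⟨a, rfl⟩
    exact ⟨fun i => op (a i), rfl⟩

lemma idl_mul_mem (I : Submodule Rᵐᵒᵖ R) {x : R} (hx : x ∈ I) (a : R) : x * a ∈ I :=
  I.smul_mem (op a) hx

lemma self_mem_idl {ι : Type} (v : ι → R) (i : ι) : v i ∈ idl v :=
  Submodule.subset_span ⟨i, rfl⟩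

variable (𝒢 : ℤ → Submodule k R) [GradedAlgebra 𝒢]

/-- homogeneous component -/
def cp (n : ℤ) : R →ₗ[k] R := GradedAlgebra.proj 𝒢 n

lemma cp_mem (n : ℤ) (r : R) : cp 𝒢 n r ∈ 𝒢 n := by
  simp only [cp, GradedAlgebra.proj_apply]; exact SetLike.coe_mem _

lemma cp_same {n : ℤ} {r : R} (h : r ∈ 𝒢 n) : cp 𝒢 n r = r := by
  simp only [cp, GradedAlgebra.proj_apply]; exact DirectSum.decompose_of_mem_same 𝒢 h

lemma cp_ne {n m : ℤ} {r : R} (h : r ∈ 𝒢 n) (hnm : n ≠ m) : cp 𝒢 m r = 0 := by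
  simp only [cp, GradedAlgebra.proj_apply]; exact DirectSum.decompose_of_mem_ne 𝒢 h hnm

lemma cp_mul_left {i n : ℤ} {x : R} (h : x ∈ 𝒢 i) (a : R) :
    cp 𝒢 n (x * a) = x * cp 𝒢 (n - i) a := by
  simp only [cp, GradedAlgebra.proj_apply]
  have := DirectSum.coe_decompose_mul_add_of_left_mem 𝒢 (j := n - i) (b := a) h
  rwa [add_sub_cancel] at this

lemma mul_mem_gr {i j n : ℤ} {x y : R} (hx : x ∈ 𝒢 i) (hy : y ∈ 𝒢 j) (h : i + j = n) :
    x * y ∈ 𝒢 n := h ▸ SetLike.mul_mem_graded hx hy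

lemma eq_of_cp {a b : R} (h : ∀ n, cp 𝒢 n a = cp 𝒢 n b) : a = b := by
  apply (DirectSum.decompose 𝒢).injective
  ext n
  have := h n
  simpa only [cp, GradedAlgebra.proj_apply] using this

/-- homogeneous right ideals -/
def IsHom (I : Submodule Rᵐᵒᵖ R) : Prop := ∀ a ∈ I, ∀ n, cp 𝒢 n a ∈ I

lemma idl_hom {ι : Type} [Fintype ι] (v : ι → R) (dv : ι → ℤ) (hv : ∀ i, v i ∈ 𝒢 (dv i)) :
    IsHom 𝒢 (idl v) := by
  intro a ha n
  obtain ⟨c, rfl⟩ := (mem_idl v a).1 ha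
  rw [map_sum]
  refine Submodule.sum_mem _ fun i _ => ?_
  rw [cp_mul_left 𝒢 (hv i)]
  exact idl_mul_mem _ (self_mem_idl v i) _

lemma hom_coeff {ι : Type} [Fintype ι] (v : ι → R) (dv : ι → ℤ) (hv : ∀ i, v i ∈ 𝒢 (dv i))
    {r : R} {n : ℤ} (hr : r ∈ 𝒢 n) (h : r ∈ idl v) :
    ∃ a : ι → R, (∀ i, a i ∈ 𝒢 (n - dv i)) ∧ r = ∑ i, v i * a i := by
  obtain ⟨c, hc⟩ := (mem_idl v r).1 h
  refine ⟨fun i => cp 𝒢 (n - dv i) (c i), fun i => cp_mem _ _ _, ?_⟩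
  conv_lhs => rw [← cp_same 𝒢 hr, hc, map_sum]
  exact Finset.sum_congr rfl fun i _ => cp_mul_left 𝒢 (hv i) _

/-- the syzygies of the family `v` are finitely generated in degrees at most `D`. -/
def SyzGen {ι : Type} [Fintype ι] (v : ι → R) (dv : ι → ℤ) (D : ℤ) : Prop :=
  ∃ (κ : Type) (_ : Fintype κ) (s : κ → ι → R) (e : κ → ℤ),
    (∀ l, e l ≤ D) ∧ (∀ l i, s l i ∈ 𝒢 (e l - dv i)) ∧ (∀ l, ∑ i, v i * s l i = 0) ∧
    ∀ a : ι → R, ∑ i, v i * a i = 0 → ∃ b : κ → R, ∀ i, a i = ∑ l, s l i * b l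

lemma SyzGen.change {ι κ : Type} [Fintype ι] [Fintype κ] {u : κ → R} {du : κ → ℤ}
    {v : ι → R} {dv : ι → ℤ} {D : ℤ} (hu : ∀ i, u i ∈ 𝒢 (du i)) (hv : ∀ i, v i ∈ 𝒢 (dv i))
    (hD : ∀ i, dv i ≤ D) (huv : idl u = idl v) (h : SyzGen 𝒢 u du D) : SyzGen 𝒢 v dv D := by
  classical
  obtain ⟨μ, _, s, e, heD, hs, hs0, hsg⟩ := h
  have h1 : ∀ j, ∃ a : ι → R, (∀ i, a i ∈ 𝒢 (du j - dv i)) ∧ u j = ∑ i, v i * a i := fun j =>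
    hom_coeff 𝒢 v dv hv (hu j) (huv ▸ self_mem_idl u j)
  have h2 : ∀ i, ∃ a : κ → R, (∀ j, a j ∈ 𝒢 (dv i - du j)) ∧ v i = ∑ j, u j * a j := fun i =>
    hom_coeff 𝒢 u du hu (hv i) (huv ▸ self_mem_idl v i)
  choose p hp hup using h1
  choose q hq hvq using h2
  -- a = (1 - p q) a + p (q a)
  refine ⟨μ ⊕ ι, inferInstance,
    Sum.elim (fun l i => ∑ j, p j i * s l j)
      (fun i' i => (if i = i' then 1 else 0) - ∑ j, p j i * q i' j),
    Sum.elim e dv, ?_, ?_, ?_, ?_⟩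
  · rintro (l | l)
    · exact heD l
    · exact hD l
  · rintro (l | l) i
    · refine Submodule.sum_mem _ fun j _ => mul_mem_gr 𝒢 (hp j i) (hs l j) ?_
      simp
    · refine Submodule.sub_mem _ ?_ (Submodule.sum_mem _ fun j _ =>
        mul_mem_gr 𝒢 (hp j i) (hq l j) ?_)
      · simp only [Sum.elim_inr]
        split_ifs with hil
        · subst hil; rw [sub_self]; exact SetLike.GradedOne.one_mem
        · exact Submodule.zero_mem _
      · simp
  · have key : ∀ t : κ → R, ∑ i, v i * ∑ j, p j i * t j = ∑ j, u j * t j := by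
      intro t
      simp_rw [Finset.mul_sum]
      rw [Finset.sum_comm]
      refine Finset.sum_congr rfl fun j _ => ?_
      rw [hup j, Finset.sum_mul]
      exact Finset.sum_congr rfl fun i _ => (mul_assoc _ _ _).symm
    rintro (l | l)
    · simp only [Sum.elim_inl]
      rw [key, hs0]
    · simp only [Sum.elim_inr, mul_sub, Finset.sum_sub_distrib]
      rw [key, ← hvq]
      simp
  · intro a ha
    have hqa : ∑ j, u j * ∑ i, q i j * a i = 0 := by
      rw [← ha]
      simp_rw [Finset.mul_sum]
      rw [Finset.sum_comm]
      refine Finset.sum_congr rfl fun j _ => ?_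
      rw [hvq j, Finset.sum_mul]
      exact Finset.sum_congr rfl fun i _ => (mul_assoc _ _ _).symm
    obtain ⟨b, hb⟩ := hsg _ hqa
    refine ⟨Sum.elim b a, fun i => ?_⟩
    rw [Fintype.sum_sum_type]
    simp only [Sum.elim_inl, Sum.elim_inr, sub_mul, Finset.sum_sub_distrib]
    have e1 : ∑ l, (∑ j, p j i * s l j) * b l = ∑ j, p j i * ∑ i', q i' j * a i' := by
      simp_rw [hb, Finset.sum_mul, Finset.mul_sum]
      rw [Finset.sum_comm]
      simp only [mul_assoc]
    have e2 : ∑ x, (∑ j, p j i * q x j) * a x = ∑ j, p j i * ∑ i', q i' j * a i' := by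
      simp_rw [Finset.sum_mul, Finset.mul_sum]
      rw [Finset.sum_comm]
      simp only [mul_assoc]
    rw [e1, e2]
    simp

lemma idl_option {ι : Type} (y : ι → R) (x : R) :
    idl (fun o : Option ι => o.elim x y) = idl y ⊔ Submodule.span Rᵐᵒᵖ {x} := by
  unfold idl
  have : Set.range (fun o : Option ι => o.elim x y) = Set.range y ∪ {x} := by
    ext z
    simp [Option.exists, eq_comm]
  rw [this, Submodule.span_union]

lemma SyzGen.cone {ι κ : Type} [Fintype ι] [Fintype κ] {y : ι → R} {dy : ι → ℤ}
    {x : R} {dx : ℤ} {c : κ → R} {dc : κ → ℤ} {D : ℤ} (hy : ∀ i, y i ∈ 𝒢 (dy i))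
    (hx : x ∈ 𝒢 dx) (hc : ∀ l, c l ∈ 𝒢 (dc l)) (hcol : idl c = colon R x (idl y))
    (hD : ∀ l, dx + dc l ≤ D) (h : SyzGen 𝒢 y dy D) :
    SyzGen 𝒢 (fun o : Option ι => o.elim x y) (fun o => o.elim dx dy) D := by
  classical
  obtain ⟨μ, _, s, e, heD, hs, hs0, hsg⟩ := h
  have h1 : ∀ l, ∃ a : ι → R, (∀ i, a i ∈ 𝒢 (dx + dc l - dy i)) ∧ x * c l = ∑ i, y i * a i := by
    intro l
    refine hom_coeff 𝒢 y dy hy (mul_mem_gr 𝒢 hx (hc l) rfl) ?_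
    have : c l ∈ colon R x (idl y) := hcol ▸ self_mem_idl c l
    exact this
  choose p hp hxp using h1
  refine ⟨μ ⊕ κ, inferInstance,
    Sum.elim (fun l o => o.elim 0 (s l)) (fun l o => o.elim (c l) (fun i => - p l i)),
    Sum.elim e (fun l => dx + dc l), ?_, ?_, ?_, ?_⟩
  · rintro (l | l)
    · exact heD l
    · exact hD l
  · rintro (l | l) (_ | i)
    · exact Submodule.zero_mem _
    · exact hs l i
    · simpa using hc l
    · exact Submodule.neg_mem _ (hp l i)
  · rintro (l | l)
    · simp [Fintype.sum_option, hs0]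
    · simp [Fintype.sum_option, hxp]
  · intro a ha
    rw [Fintype.sum_option] at ha
    simp only [Option.elim] at ha
    have h2 : a none ∈ idl c := by
      rw [hcol]
      change x * a none ∈ idl y
      rw [mem_idl]
      refine ⟨fun i => - a (some i), ?_⟩
      simp only [mul_neg, Finset.sum_neg_distrib]
      exact eq_neg_of_add_eq_zero_left ha
    obtain ⟨b, hb⟩ := (mem_idl _ _).1 h2
    have h3 : ∑ i, y i * (a (some i) + ∑ l, p l i * b l) = 0 := by
      simp only [mul_add, Finset.sum_add_distrib]
      rw [← ha, add_comm]
      congr 1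
      rw [hb]
      simp_rw [Finset.mul_sum]
      rw [Finset.sum_comm]
      refine Finset.sum_congr rfl fun l _ => ?_
      rw [← mul_assoc, hxp, Finset.sum_mul]
      exact Finset.sum_congr rfl fun i _ => (mul_assoc _ _ _).symm
    obtain ⟨b', hb'⟩ := hsg _ h3
    refine ⟨Sum.elim b' b, ?_⟩
    rintro (_ | i)
    · simp [Fintype.sum_sum_type, hb]
    · have := hb' i
      simp [Fintype.sum_sum_type, ← this]

/-- Hilbert function of a right ideal -/
noncomputable def Hf (I : Submodule Rᵐᵒᵖ R) (n : ℤ) : ℤ :=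
  (Module.finrank k ↥(𝒢 n ⊓ I.restrictScalars k) : ℤ)

lemma Hf_step [∀ n, FiniteDimensional k (𝒢 n)] (J : Submodule Rᵐᵒᵖ R) (hJ : IsHom 𝒢 J)
    (x : R) (dx : ℤ) (hx : x ∈ 𝒢 dx) (n : ℤ) :
    Hf 𝒢 (J ⊔ Submodule.span Rᵐᵒᵖ {x}) n =
      Hf 𝒢 J n + (Hf 𝒢 ⊤ (n - dx) - Hf 𝒢 (colon R x J) (n - dx)) := by
  set I := J ⊔ Submodule.span Rᵐᵒᵖ {x} with hI
  have hIx : ∀ r, r ∈ I ↔ ∃ j ∈ J, ∃ a : R, j + x * a = r := by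
    intro r
    rw [hI, Submodule.mem_sup]
    constructor
    · rintro ⟨j, hj, z, hz, rfl⟩
      obtain ⟨c, rfl⟩ := Submodule.mem_span_singleton.1 hz
      exact ⟨j, hj, unop c, rfl⟩
    · rintro ⟨j, hj, a, rfl⟩
      exact ⟨j, hj, x * a, Submodule.mem_span_singleton.2 ⟨op a, rfl⟩, rfl⟩
  let g : R →ₗ[k] R ⧸ J.restrictScalars k := (J.restrictScalars k).mkQ
  let f : R →ₗ[k] R ⧸ J.restrictScalars k := g ∘ₗ LinearMap.mulLeft k x
  have e1 := finrank_map_add f (𝒢 (n - dx))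
  have e2 := finrank_map_add g (𝒢 n ⊓ I.restrictScalars k)
  have hmap : (𝒢 (n - dx)).map f = (𝒢 n ⊓ I.restrictScalars k).map g := by
    ext z
    constructor
    · rintro ⟨a, ha, rfl⟩
      refine ⟨x * a, ⟨mul_mem_gr 𝒢 hx ha (by ring), ?_⟩, rfl⟩
      exact (hIx _).2 ⟨0, J.zero_mem, a, by simp⟩
    · rintro ⟨r, ⟨hr, hrI⟩, rfl⟩
      obtain ⟨j, hj, a, rfl⟩ := (hIx r).1 hrI
      refine ⟨cp 𝒢 (n - dx) a, cp_mem _ _ _, ?_⟩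
      have : j + x * a = cp 𝒢 n j + x * cp 𝒢 (n - dx) a := by
        rw [← cp_mul_left 𝒢 hx, ← map_add, cp_same 𝒢 hr]
      rw [this]
      have h0 : g (cp 𝒢 n j) = 0 :=
        (Submodule.Quotient.mk_eq_zero _).2 (hJ j hj n)
      rw [map_add, h0, zero_add]
      rfl
  have k1 : 𝒢 (n - dx) ⊓ LinearMap.ker f = 𝒢 (n - dx) ⊓ (colon R x J).restrictScalars k := by
    congr 1
    rw [LinearMap.ker_comp, Submodule.ker_mkQ]
    rfl
  have k2 : 𝒢 n ⊓ I.restrictScalars k ⊓ LinearMap.ker g = 𝒢 n ⊓ J.restrictScalars k := by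
    rw [Submodule.ker_mkQ, inf_assoc]
    congr 1
    rw [inf_eq_right]
    intro z hz
    exact (le_sup_left : J ≤ I) hz
  have k3 : 𝒢 (n - dx) ⊓ (⊤ : Submodule Rᵐᵒᵖ R).restrictScalars k = 𝒢 (n - dx) := by
    simp
  rw [k1, hmap] at e1
  rw [k2] at e2
  unfold Hf
  rw [k3, ← e1, ← e2]
  push_cast
  ring

end GradedBasics

section Families

variable {k : Type} [Field k] {R : Type} [Ring R] [Algebra k R]
variable (𝒢 : ℤ → Submodule k R)

set_option linter.unusedSectionVars false

/-- ideals generated in degrees at most `d` -/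
def InF (d : ℕ) (I : Submodule Rᵐᵒᵖ R) : Prop :=
  ∃ (ι : Type) (_ : Fintype ι) (v : ι → R) (dv : ι → ℤ),
    (∀ i, dv i ≤ d) ∧ (∀ i, v i ∈ 𝒢 (dv i)) ∧ idl v = I

/-- the inductive property of coherent families -/
def CohStep (d : ℕ) : Prop :=
  ∀ I, InF 𝒢 d I → I ≠ ⊥ → ∃ J, InF 𝒢 d J ∧ J ≠ I ∧ ∃ (x : R) (dx : ℕ), x ∈ 𝒢 dx ∧
    I = J ⊔ Submodule.span Rᵐᵒᵖ {x} ∧ InF 𝒢 d (colon R x J)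

/-- size of the low degree part -/
noncomputable def mu (d : ℕ) (I : Submodule Rᵐᵒᵖ R) : ℕ :=
  ∑ n ∈ Finset.range (d + 1), Module.finrank k ↥(𝒢 n ⊓ I.restrictScalars k)

variable [GradedAlgebra 𝒢] [∀ n, FiniteDimensional k (𝒢 n)]

lemma InF.hom {d : ℕ} {I : Submodule Rᵐᵒᵖ R} (h : InF 𝒢 d I) : IsHom 𝒢 I := by
  obtain ⟨ι, _, v, dv, -, hv, rfl⟩ := h
  exact idl_hom 𝒢 v dv hv

lemma mu_lt (hneg : ∀ n < 0, 𝒢 n = ⊥) {d : ℕ} {I J : Submodule Rᵐᵒᵖ R} (hI : InF 𝒢 d I)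
    (hJI : J ≤ I) (hne : J ≠ I) : mu 𝒢 d J < mu 𝒢 d I := by
  have hle : ∀ n : ℤ, 𝒢 n ⊓ J.restrictScalars k ≤ 𝒢 n ⊓ I.restrictScalars k := fun n =>
    inf_le_inf_left _ hJI
  have hfr : ∀ n : ℤ, Module.finrank k ↥(𝒢 n ⊓ J.restrictScalars k) ≤
      Module.finrank k ↥(𝒢 n ⊓ I.restrictScalars k) := fun n => Submodule.finrank_mono (hle n)
  unfold mu
  refine lt_of_le_of_ne (Finset.sum_le_sum fun n _ => hfr n) fun heq => hne ?_
  have h1 := (Finset.sum_eq_sum_iff_of_le (fun (n : ℕ) _ => hfr n)).1 heq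
  refine le_antisymm hJI ?_
  obtain ⟨ι, _, v, dv, hd, hv, rfl⟩ := hI
  refine Submodule.span_le.2 ?_
  rintro _ ⟨i, rfl⟩
  by_cases h0 : dv i < 0
  · have := hv i
    rw [hneg _ h0, Submodule.mem_bot] at this
    rw [this]; exact J.zero_mem
  · obtain ⟨n, hn⟩ := Int.eq_ofNat_of_zero_le (not_lt.1 h0)
    have hnd : n ≤ d := by have := hd i; omega
    have h2 := Submodule.eq_of_le_of_finrank_eq (hle n) (h1 n (by simp; omega))
    have h3 : v i ∈ 𝒢 n ⊓ (idl v).restrictScalars k := ⟨hn ▸ hv i, self_mem_idl v i⟩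
    rw [← h2] at h3
    exact h3.2

lemma dx_le (hneg : ∀ n < 0, 𝒢 n = ⊥) {d : ℕ} {I J : Submodule Rᵐᵒᵖ R} (hI : InF 𝒢 d I)
    (hJ : InF 𝒢 d J) (hne : J ≠ I) {x : R} {dx : ℕ} (hx : x ∈ 𝒢 dx)
    (hIJ : I = J ⊔ Submodule.span Rᵐᵒᵖ {x}) : dx ≤ d := by
  by_contra hlt
  refine hne (le_antisymm (hIJ ▸ le_sup_left) ?_)
  obtain ⟨ι, _, v, dv, hd, hv, rfl⟩ := hI
  refine Submodule.span_le.2 ?_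
  rintro _ ⟨i, rfl⟩
  have h1 : v i ∈ J ⊔ Submodule.span Rᵐᵒᵖ {x} := hIJ ▸ self_mem_idl v i
  obtain ⟨j, hj, z, hz, hjz⟩ := Submodule.mem_sup.1 h1
  obtain ⟨c, rfl⟩ := Submodule.mem_span_singleton.1 hz
  have h2 : v i = cp 𝒢 (dv i) j + x * cp 𝒢 (dv i - dx) (unop c) := by
    rw [← cp_mul_left 𝒢 hx, ← cp_same 𝒢 (hv i), ← hjz]
    rw [map_add]
    rfl
  have h3 := cp_mem 𝒢 (dv i - dx) (unop c)
  rw [hneg _ (by have := hd i; omega), Submodule.mem_bot] at h3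
  rw [h3, mul_zero, add_zero] at h2
  rw [h2]
  exact hJ.hom 𝒢 j hj _

lemma fam_induction (hneg : ∀ n < 0, 𝒢 n = ⊥) {d : ℕ} (hcoh : CohStep 𝒢 d)
    (P : Submodule Rᵐᵒᵖ R → Prop) (hbot : P ⊥)
    (hstep : ∀ I J x (dx : ℕ), InF 𝒢 d I → InF 𝒢 d J → I ≠ ⊥ → J ≠ I → x ∈ 𝒢 dx → dx ≤ d →
      I = J ⊔ Submodule.span Rᵐᵒᵖ {x} → InF 𝒢 d (colon R x J) →
      (∀ I', InF 𝒢 d I' → I' ≤ I → I' ≠ I → P I') → P I) :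
    ∀ I, InF 𝒢 d I → P I := by
  intro I
  induction hm : mu 𝒢 d I using Nat.strong_induction_on generalizing I with
  | _ m ih =>
    intro hI
    by_cases h0 : I = ⊥
    · rw [h0]; exact hbot
    · obtain ⟨J, hJ, hne, x, dx, hx, hIJ, hcol⟩ := hcoh I hI h0
      refine hstep I J x dx hI hJ h0 hne hx (dx_le 𝒢 hneg hI hJ hne hx hIJ) hIJ hcol ?_
      intro I' hI' hle hne'
      exact ih _ (hm ▸ mu_lt 𝒢 hneg hI hle hne') I' rfl hI'

lemma syz_bound (hneg : ∀ n < 0, 𝒢 n = ⊥) {d : ℕ} (hcoh : CohStep 𝒢 d)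
    {ι : Type} [Fintype ι] (v : ι → R) (dv : ι → ℤ) (hd : ∀ i, dv i ≤ d)
    (hv : ∀ i, v i ∈ 𝒢 (dv i)) : SyzGen 𝒢 v dv (2 * d) := by
  have key : ∀ I, InF 𝒢 d I → ∃ (κ : Type) (_ : Fintype κ) (u : κ → R) (du : κ → ℤ),
      (∀ i, u i ∈ 𝒢 (du i)) ∧ idl u = I ∧ SyzGen 𝒢 u du (2 * d) := by
    refine fam_induction 𝒢 hneg hcoh _ ?_ ?_
    · refine ⟨Empty, inferInstance, Empty.elim, Empty.elim, fun i => i.elim, by simp [idl],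
        Empty, inferInstance, Empty.elim, Empty.elim, fun i => i.elim, fun i => i.elim,
        fun i => i.elim, fun a _ => ⟨Empty.elim, fun i => i.elim⟩⟩
    · intro I J x dx hI hJ h0 hne hx hdx hIJ hcol ih
      obtain ⟨κ, _, u, du, hu, huJ, hs⟩ := ih J hJ (hIJ ▸ le_sup_left) hne
      obtain ⟨γ, _, c, dc, hdc, hc, hcc⟩ := hcol
      refine ⟨Option κ, inferInstance, fun o => o.elim x u, fun o => o.elim (dx : ℤ) du, ?_, ?_, ?_⟩
      · rintro (_ | i)
        · exact hx
        · exact hu i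
      · rw [idl_option, huJ, hIJ]
      · refine SyzGen.cone 𝒢 hu hx hc (by rw [hcc, huJ]) ?_ hs
        intro l
        have := hdc l
        omega
  obtain ⟨κ, _, u, du, hu, huI, hs⟩ := key (idl v) ⟨ι, inferInstance, v, dv, hd, hv, rfl⟩
  exact hs.change 𝒢 hu hv (fun i => by have := hd i; omega) huI

end Families

section Finiteness

/-- irreducibility with respect to a function algebra -/
def Irr {k T : Type} [Field k] (𝒪 : Subalgebra k (T → k)) (Z : Set T) : Prop :=
  Z.Nonempty ∧ ∀ f ∈ 𝒪, ∀ g ∈ 𝒪, (∃ t ∈ Z, f t ≠ 0) → (∃ t ∈ Z, g t ≠ 0) →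
    ∃ t ∈ Z, f t * g t ≠ 0

lemma Irr.prod {k T : Type} [Field k] {𝒪 : Subalgebra k (T → k)} {Z : Set T} (hZ : Irr 𝒪 Z)
    {α : Type} (s : Finset α) (F : α → T → k) (hF : ∀ i ∈ s, F i ∈ 𝒪)
    (h : ∀ i ∈ s, ∃ t ∈ Z, F i t ≠ 0) : ∃ t ∈ Z, (∏ i ∈ s, F i) t ≠ 0 := by
  classical
  induction s using Finset.induction_on with
  | empty => obtain ⟨t, ht⟩ := hZ.1; exact ⟨t, ht, by simp⟩
  | insert a s ha ih =>
    rw [Finset.prod_insert ha]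
    exact hZ.2 _ (hF a (by simp)) _ (𝒪.prod_mem fun i hi => hF i (by simp [hi]))
      (h a (by simp)) (ih (fun i hi => hF i (by simp [hi])) (fun i hi => h i (by simp [hi])))

lemma noeth_fin {k T H : Type} [Field k] (𝒪 : Subalgebra k (T → k)) [IsNoetherianRing 𝒪]
    (h : T → H) (hgen : ∀ Z : Set T, Irr 𝒪 Z → ∃ f ∈ 𝒪, (∃ t ∈ Z, f t ≠ 0) ∧
      (h '' {t | t ∈ Z ∧ f t ≠ 0}).Finite) : (Set.range h).Finite := by
  have key : ∀ a : Ideal 𝒪, (h '' {t | ∀ f ∈ a, (f : T → k) t = 0}).Finite := by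
    intro a
    induction a using WellFoundedGT.induction with
    | _ a ih =>
      set Z : Set T := {t | ∀ f ∈ a, (f : T → k) t = 0} with hZ
      have hsub : ∀ f : 𝒪, (∃ t ∈ Z, (f : T → k) t ≠ 0) →
          (h '' {t | t ∈ Z ∧ (f : T → k) t = 0}).Finite := by
        rintro f ⟨t, ht, hft⟩
        have hlt : a < a ⊔ Ideal.span {f} := by
          refine lt_of_le_of_ne le_sup_left fun he => hft (ht f ?_)
          rw [he]
          exact (le_sup_right : _ ≤ a ⊔ Ideal.span {f}) (Ideal.mem_span_singleton_self f)
        refine (ih _ hlt).subset (Set.image_mono ?_)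
        rintro t' ⟨ht', hft'⟩ g hg
        obtain ⟨g1, hg1, g2, hg2, rfl⟩ := Submodule.mem_sup.1 hg
        obtain ⟨c, rfl⟩ := Ideal.mem_span_singleton.1 hg2
        have := ht' g1 hg1
        simp [this, hft']
      by_cases hne : Z.Nonempty
      · by_cases hirr : Irr 𝒪 Z
        · obtain ⟨f, hf, hft, hfin⟩ := hgen Z hirr
          refine (hfin.union (hsub ⟨f, hf⟩ hft)).subset ?_
          rintro _ ⟨t, ht, rfl⟩
          by_cases h0 : f t = 0
          · exact Or.inr ⟨t, ⟨ht, h0⟩, rfl⟩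
          · exact Or.inl ⟨t, ⟨ht, h0⟩, rfl⟩
        · unfold Irr at hirr
          push Not at hirr
          obtain ⟨f, hf, g, hg, hft, hgt, hfg⟩ := hirr hne
          refine ((hsub ⟨f, hf⟩ hft).union (hsub ⟨g, hg⟩ hgt)).subset ?_
          rintro _ ⟨t, ht, rfl⟩
          rcases mul_eq_zero.1 (hfg t ht) with h0 | h0
          · exact Or.inl ⟨t, ⟨ht, h0⟩, rfl⟩
          · exact Or.inr ⟨t, ⟨ht, h0⟩, rfl⟩
      · rw [Set.not_nonempty_iff_eq_empty.1 hne]; simp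
  refine (key ⊥).subset ?_
  rintro _ ⟨t, rfl⟩
  exact ⟨t, by simp, rfl⟩

/-- polynomial functions on a finite dimensional vector space -/
lemma exists_poly_alg (k T : Type) [Field k] [AddCommGroup T] [Module k T]
    [FiniteDimensional k T] : ∃ 𝒪 : Subalgebra k (T → k), IsNoetherianRing 𝒪 ∧
      ∀ l : T →ₗ[k] k, (fun t => l t) ∈ 𝒪 := by
  let b := Module.finBasis k T
  refine ⟨Algebra.adjoin k (Set.range fun j => fun t => b.repr t j), ?_, ?_⟩
  · have : (Algebra.adjoin k (Set.range fun j => fun t => b.repr t j)).FG :=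
      Subalgebra.fg_def.2 ⟨_, Set.finite_range _, rfl⟩
    have := (Subalgebra.fg_iff_finiteType _).1 this
    exact Algebra.FiniteType.isNoetherianRing k _
  · intro l
    have : (fun t => l t) = ∑ j, l (b j) • (fun t => b.repr t j) := by
      ext t
      have h1 := congrArg l (b.sum_repr t)
      rw [map_sum] at h1
      rw [← h1, Finset.sum_apply]
      refine Finset.sum_congr rfl fun j _ => ?_
      rw [map_smul, Pi.smul_apply, smul_eq_mul, smul_eq_mul, mul_comm]
    rw [this]
    refine Subalgebra.sum_mem _ fun j _ => Subalgebra.smul_mem _ ?_ _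
    exact Algebra.subset_adjoin ⟨j, rfl⟩

variable {k : Type} [Field k] {R : Type} [Ring R] [Algebra k R]

/-- the map `a ↦ ∑ vᵢ aᵢ` -/
def phi (k : Type) [Field k] {R : Type} [Ring R] [Algebra k R] {ι : Type} [Fintype ι]
    (v : ι → R) : (ι → R) →ₗ[k] R :=
  ∑ i, LinearMap.mulLeft k (v i) ∘ₗ LinearMap.proj i

lemma phi_apply {ι : Type} [Fintype ι] (v a : ι → R) : phi k v a = ∑ i, v i * a i := by
  simp [phi]

variable (𝒢 : ℤ → Submodule k R)

/-- degree `n` part of the graded free module -/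
def Egr {ι : Type} (dg : ι → ℤ) (n : ℤ) : Submodule k (ι → R) where
  carrier := {a | ∀ i, a i ∈ 𝒢 (n - dg i)}
  add_mem' ha hb i := Submodule.add_mem _ (ha i) (hb i)
  zero_mem' _ := Submodule.zero_mem _
  smul_mem' c _ ha i := Submodule.smul_mem _ c (ha i)

/-- description of the graded piece of a free module -/
def EgrEquiv {ι : Type} (dg : ι → ℤ) (n : ℤ) : Egr 𝒢 dg n ≃ₗ[k] ((i : ι) → 𝒢 (n - dg i)) where
  toFun a i := ⟨a.1 i, a.2 i⟩
  invFun b := ⟨fun i => b i, fun i => (b i).2⟩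
  map_add' _ _ := rfl
  map_smul' _ _ := rfl
  left_inv _ := rfl
  right_inv _ := rfl

instance Egr_fd {ι : Type} [Finite ι] (dg : ι → ℤ) (n : ℤ) [∀ n, FiniteDimensional k (𝒢 n)] :
    FiniteDimensional k (Egr 𝒢 dg n) :=
  Module.Finite.equiv (EgrEquiv 𝒢 dg n).symm

lemma Egr_finrank {ι : Type} [Fintype ι] (dg : ι → ℤ) (n : ℤ) [∀ n, FiniteDimensional k (𝒢 n)] :
    Module.finrank k (Egr 𝒢 dg n) = ∑ i, Module.finrank k (𝒢 (n - dg i)) := by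
  rw [(EgrEquiv 𝒢 dg n).finrank_eq, Module.finrank_pi_fintype]

variable [GradedAlgebra 𝒢]

lemma map_phi {ι : Type} [Fintype ι] (v : ι → R) (dg : ι → ℤ) (hv : ∀ i, v i ∈ 𝒢 (dg i))
    (n : ℤ) : (Egr 𝒢 dg n).map (phi k v) = 𝒢 n ⊓ (idl v).restrictScalars k := by
  ext r
  constructor
  · rintro ⟨a, ha, rfl⟩
    rw [phi_apply]
    refine ⟨Submodule.sum_mem _ fun i _ => mul_mem_gr 𝒢 (hv i) (ha i) (by ring), ?_⟩
    exact (mem_idl _ _).2 ⟨a, rfl⟩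
  · rintro ⟨hr, hrv⟩
    obtain ⟨a, ha, rfl⟩ := hom_coeff 𝒢 v dg hv hr hrv
    exact ⟨a, ha, phi_apply _ _⟩

variable [∀ n, FiniteDimensional k (𝒢 n)]

theorem finite_hilb (hneg : ∀ n < 0, 𝒢 n = ⊥) {ι : Type} [Fintype ι] (dg : ι → ℤ) (D : ℤ)
    (hS : ∀ v : ι → R, (∀ i, v i ∈ 𝒢 (dg i)) → SyzGen 𝒢 v dg D) :
    {h : ℤ → ℤ | ∃ v : ι → R, (∀ i, v i ∈ 𝒢 (dg i)) ∧ h = Hf 𝒢 (idl v)}.Finite := by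
  classical
  let T : Type := (i : ι) → 𝒢 (dg i)
  obtain ⟨𝒪, hN, hlin⟩ := exists_poly_alg k T
  let vl : T → ι → R := fun t i => t i
  have hvl : ∀ t i, vl t i ∈ 𝒢 (dg i) := fun t i => (t i).2
  have hrange : {h : ℤ → ℤ | ∃ v : ι → R, (∀ i, v i ∈ 𝒢 (dg i)) ∧ h = Hf 𝒢 (idl v)} =
      Set.range (fun t : T => Hf 𝒢 (idl (vl t))) := by
    ext h
    constructor
    · rintro ⟨v, hv, rfl⟩
      exact ⟨fun i => ⟨v i, hv i⟩, rfl⟩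
    · rintro ⟨t, rfl⟩
      exact ⟨vl t, hvl t, rfl⟩
  rw [hrange]
  refine noeth_fin 𝒪 _ ?_
  intro Z hZ
  let rk : T → ℤ → ℕ := fun t n => Module.finrank k ((Egr 𝒢 dg n).map (phi k (vl t)))
  have hrk : ∀ t n, Hf 𝒢 (idl (vl t)) n = rk t n := by
    intro t n
    change _ = ((Module.finrank k ((Egr 𝒢 dg n).map (phi k (vl t))) : ℕ) : ℤ)
    rw [map_phi 𝒢 (vl t) dg (hvl t) n]
    rfl
  have hrkker : ∀ t n, rk t n + Module.finrank k ↥(Egr 𝒢 dg n ⊓ LinearMap.ker (phi k (vl t))) =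
      Module.finrank k (Egr 𝒢 dg n) := fun t n => finrank_map_add _ _
  have hreg : ∀ e : ι → R, Reg 𝒪 (fun t => phi k (vl t) e) := by
    intro e l
    let L : T →ₗ[k] R := ∑ i, LinearMap.mulRight k (e i) ∘ₗ (𝒢 (dg i)).subtype ∘ₗ LinearMap.proj i
    have := hlin (l ∘ₗ L)
    have hL : ∀ t, L t = phi k (vl t) e := by
      intro t
      simp [L, phi_apply, vl]
      rfl
    simpa [hL] using this
  -- maximal ranks
  have hmax : ∀ n, ∃ t ∈ Z, ∀ t' ∈ Z, rk t' n ≤ rk t n := by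
    intro n
    have hbd : (Set.image (fun t => rk t n) Z).Finite := by
      refine (Set.finite_Iic (Module.finrank k (Egr 𝒢 dg n))).subset ?_
      rintro _ ⟨t, -, rfl⟩
      have := hrkker t n
      simp only [Set.mem_Iic]
      omega
    obtain ⟨t, ht, hmx⟩ := Set.exists_max_image _ id hbd (hZ.1.image _)
    obtain ⟨t0, ht0, rfl⟩ := ht
    exact ⟨t0, ht0, fun t' ht' => hmx _ ⟨t', ht', rfl⟩⟩
  choose tm htm hmx using hmax
  -- open set of maximal rank
  have hopen : ∀ n, ∃ f ∈ 𝒪, f (tm n) ≠ 0 ∧ ∀ t, f t ≠ 0 → rk (tm n) n ≤ rk t n := by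
    intro n
    let b := Module.finBasis k ((Egr 𝒢 dg n).map (phi k (vl (tm n))))
    have hb : ∀ i, ∃ e ∈ Egr 𝒢 dg n, phi k (vl (tm n)) e = b i := fun i => (b i).2
    choose e heE he using hb
    obtain ⟨g, hg, hg0, hgli⟩ := open_li 𝒪 (fun i t => phi k (vl t) (e i)) (fun i => hreg _) (tm n)
      (by
        simp only [he]
        exact b.linearIndependent.map' (Submodule.subtype _) (by simp))
    refine ⟨g, hg, hg0, fun t ht => ?_⟩
    have hli := hgli t ht
    have h1 := finrank_span_eq_card hli
    have h2 : Submodule.span k (Set.range fun i => phi k (vl t) (e i)) ≤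
        (Egr 𝒢 dg n).map (phi k (vl t)) := by
      rw [Submodule.span_le]
      rintro _ ⟨i, rfl⟩
      exact ⟨e i, heE i, rfl⟩
    have h3 := Submodule.finrank_mono h2
    rw [h1, Fintype.card_fin] at h3
    exact h3
  choose F hF hF0 hFrk using hopen
  refine ⟨∏ n ∈ Finset.Icc 0 D, F n, 𝒪.prod_mem fun n _ => hF n,
    hZ.prod _ F (fun n _ => hF n) (fun n _ => ⟨tm n, htm n, hF0 n⟩), ?_⟩
  refine (Set.finite_singleton (fun n => (rk (tm n) n : ℤ))).subset ?_
  rintro _ ⟨t0, ⟨ht0, hft0⟩, rfl⟩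
  simp only [Set.mem_singleton_iff]
  ext n
  rw [hrk]
  -- low degree ranks are maximal
  have hlow : ∀ j ≤ D, rk (tm j) j ≤ rk t0 j := by
    intro j hj
    by_cases hj0 : j < 0
    · have : rk (tm j) j = 0 := by
        have := hrk (tm j) j
        unfold Hf at this
        rw [hneg j hj0, bot_inf_eq, finrank_bot] at this
        exact_mod_cast this.symm
      omega
    · refine hFrk j t0 fun h0 => hft0 ?_
      rw [Finset.prod_apply]
      exact Finset.prod_eq_zero (i := j) (by simp; omega) h0
  obtain ⟨κ, _, s, e, heD, hs, hs0, hsg⟩ := hS (vl t0) (hvl t0)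
  -- extensions of syzygies
  have hext : ∀ l, ∃ f ∈ 𝒪, f t0 ≠ 0 ∧ ∃ W : T → (ι → R), Reg 𝒪 W ∧ W t0 = s l ∧
      ∀ t ∈ Z, f t ≠ 0 → W t ∈ Egr 𝒢 dg (e l) ∧ phi k (vl t) (W t) = 0 := by
    intro l
    obtain ⟨f, hf, hf0, W, hW, hW0, hWk⟩ := ker_extend 𝒪
      (fun t => (phi k (vl t)).domRestrict (Egr 𝒢 dg (e l))) (fun a => hreg a) Z t0
      (by
        intro t ht
        rw [LinearMap.range_domRestrict, LinearMap.range_domRestrict]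
        exact (hmx (e l) t ht).trans (hlow _ (heD l)))
      ⟨s l, hs l⟩ (by
        rw [LinearMap.domRestrict_apply, phi_apply]
        exact hs0 l)
    refine ⟨f, hf, hf0, fun t => (W t : ι → R), hW.comp 𝒪 (Submodule.subtype _), by simp only [hW0], ?_⟩
    intro t ht hft
    exact ⟨(W t).2, hWk t ht hft⟩
  choose f hf hf0 W hW hW0 hWk using hext
  -- the spanning set of syzygies of degree n
  let S : Set (ι → R) := {w | ∃ l, ∃ a ∈ 𝒢 (n - e l), w = fun i => s l i * a}
  have hspan : Submodule.span k S = Egr 𝒢 dg n ⊓ LinearMap.ker (phi k (vl t0)) := by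
    apply le_antisymm
    · rw [Submodule.span_le]
      rintro _ ⟨l, a, ha, rfl⟩
      refine ⟨fun i => mul_mem_gr 𝒢 (hs l i) ha (by ring), ?_⟩
      change phi k (vl t0) _ = 0
      rw [phi_apply]
      simp_rw [← mul_assoc]
      rw [← Finset.sum_mul, hs0, zero_mul]
    · rintro w ⟨hwE, hwk⟩
      have hwk' : phi k (vl t0) w = 0 := hwk
      rw [phi_apply] at hwk'
      obtain ⟨b, hb⟩ := hsg w hwk'
      have : w = ∑ l, fun i => s l i * cp 𝒢 (n - e l) (b l) := by
        ext i
        rw [Finset.sum_apply]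
        conv_lhs => rw [← cp_same 𝒢 (hwE i), hb i, map_sum]
        refine Finset.sum_congr rfl fun l _ => ?_
        rw [cp_mul_left 𝒢 (hs l i)]
        have hdeg : n - dg i - (e l - dg i) = n - e l := by ring
        rw [hdeg]
      rw [this]
      refine Submodule.sum_mem _ fun l _ => Submodule.subset_span ⟨l, _, cp_mem _ _ _, rfl⟩
  obtain ⟨B, hBS, hBspan, hBli⟩ := exists_linearIndependent k S
  rw [hspan] at hBspan
  have hBfin : B.Finite := by
    have : FiniteDimensional k (Submodule.span k B) := by rw [hBspan]; infer_instance
    have hli' : LinearIndependent k (fun x : B => (⟨x, Submodule.subset_span x.2⟩ : Submodule.span k B)) :=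
      LinearIndependent.of_comp (Submodule.subtype _) hBli
    exact hli'.finite
  have : Fintype B := hBfin.fintype
  have hBS' : ∀ x : B, ∃ l, ∃ a ∈ 𝒢 (n - e l), (x : ι → R) = fun i => s l i * a := fun x => hBS x.2
  choose lx ax hax hxx using hBS'
  let mr : R → (ι → R) →ₗ[k] (ι → R) := fun a =>
    LinearMap.pi fun i => LinearMap.mulRight k a ∘ₗ LinearMap.proj i
  obtain ⟨g, hg, hg0, hgli⟩ := open_li 𝒪 (fun (x : B) t => mr (ax x) (W (lx x) t))
    (fun x => (hW (lx x)).comp 𝒪 _) t0 (by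
      have : (fun x : B => mr (ax x) (W (lx x) t0)) = fun x : B => (x : ι → R) := by
        ext x i
        rw [hW0, hxx]
        rfl
      rw [this]
      exact hBli)
  obtain ⟨t, ht, hprod⟩ := hZ.2 _ (𝒪.mul_mem hg (𝒪.prod_mem fun l (_ : l ∈ Finset.univ) => hf l))
    _ (hF n) ⟨t0, ht0, by
      rw [Pi.mul_apply, Finset.prod_apply]
      exact mul_ne_zero hg0 (Finset.prod_ne_zero_iff.2 fun l _ => hf0 l)⟩ ⟨tm n, htm n, hF0 n⟩
  rw [Pi.mul_apply, Finset.prod_apply] at hprod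
  have hFt := right_ne_zero_of_mul hprod
  have hgt := left_ne_zero_of_mul (left_ne_zero_of_mul hprod)
  have hft := Finset.prod_ne_zero_iff.1 (right_ne_zero_of_mul (left_ne_zero_of_mul hprod))
  have hle : Submodule.span k (Set.range fun x : B => mr (ax x) (W (lx x) t)) ≤
      Egr 𝒢 dg n ⊓ LinearMap.ker (phi k (vl t)) := by
    rw [Submodule.span_le]
    rintro _ ⟨x, rfl⟩
    obtain ⟨hE, hk⟩ := hWk (lx x) t ht (hft _ (Finset.mem_univ _))
    refine ⟨fun i => mul_mem_gr 𝒢 (hE i) (hax x) (by ring), ?_⟩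
    change phi k (vl t) _ = 0
    rw [phi_apply] at hk ⊢
    have : ∀ i, vl t i * mr (ax x) (W (lx x) t) i = vl t i * W (lx x) t i * ax x := fun i =>
      (mul_assoc _ _ _).symm
    simp_rw [this]
    rw [← Finset.sum_mul, hk, zero_mul]
  have c1 := Submodule.finrank_mono hle
  rw [finrank_span_eq_card (hgli t hgt)] at c1
  have c2 : Module.finrank k ↥(Egr 𝒢 dg n ⊓ LinearMap.ker (phi k (vl t0))) = Fintype.card B := by
    rw [← hBspan]
    have := finrank_span_eq_card hBli
    rwa [Subtype.range_coe] at this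
  have c3 := hrkker t n
  have c4 := hrkker t0 n
  have c5 := hFrk n t hFt
  have c6 := hmx n t0 ht0
  have : rk t0 n = rk (tm n) n := by omega
  rw [this]

end Finiteness

section Rationality

open Polynomial Module

/-- the shift operator on integer sequences -/
def Sh : (ℤ → ℤ) →ₗ[ℤ] (ℤ → ℤ) := LinearMap.funLeft ℤ ℤ (fun n => n - 1)

lemma Sh_pow_apply (i : ℕ) (f : ℤ → ℤ) (N : ℤ) : (Sh ^ i) f N = f (N - i) := by
  induction i generalizing N with
  | zero => simp
  | succ i ih =>
    rw [pow_succ', Module.End.mul_apply]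
    change (Sh ^ i) f (N - 1) = _
    rw [ih]
    congr 1
    push_cast
    ring

lemma aeval_Sh (q : ℤ[X]) (f : ℤ → ℤ) (N : ℤ) :
    aeval Sh q f N = ∑ i ∈ Finset.range (q.natDegree + 1), q.coeff i * f (N - i) := by
  rw [aeval_eq_sum_range, LinearMap.sum_apply, Finset.sum_apply]
  refine Finset.sum_congr rfl fun i _ => ?_
  rw [LinearMap.smul_apply, Pi.smul_apply, Sh_pow_apply, smul_eq_mul]

lemma aeval_Sh_supp (q : ℤ[X]) {f : ℤ → ℤ} (hf : (Function.support f).Finite) :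
    (Function.support (aeval Sh q f)).Finite := by
  have : Function.support (aeval Sh q f) ⊆
      ⋃ i ∈ Finset.range (q.natDegree + 1), (fun n : ℤ => n + i) '' Function.support f := by
    intro N hN
    rw [Function.mem_support, aeval_Sh] at hN
    obtain ⟨i, hi, hne⟩ := Finset.exists_ne_zero_of_sum_ne_zero hN
    simp only [Set.mem_iUnion]
    exact ⟨i, hi, N - i, right_ne_zero_of_mul hne, by simp⟩
  refine Set.Finite.subset ?_ this
  exact Set.Finite.biUnion (Finset.finite_toSet _) fun i _ => hf.image _

/-- rational integer sequences -/
def Rat' (f : ℤ → ℤ) : Prop :=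
  ∃ q : ℤ[X], q.coeff 0 = 1 ∧ (Function.support (aeval Sh q f)).Finite

lemma Rat'.add {f g : ℤ → ℤ} (hf : Rat' f) (hg : Rat' g) : Rat' (f + g) := by
  obtain ⟨p, hp, hpf⟩ := hf
  obtain ⟨q, hq, hqg⟩ := hg
  refine ⟨p * q, by rw [mul_coeff_zero, hp, hq, one_mul], ?_⟩
  rw [map_add]
  refine Set.Finite.subset (Set.Finite.union ?_ ?_) (Function.support_add _ _)
  · rw [mul_comm, map_mul, Module.End.mul_apply]
    exact aeval_Sh_supp q hpf
  · rw [map_mul, Module.End.mul_apply]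
    exact aeval_Sh_supp p hqg

lemma Rat'.neg {f : ℤ → ℤ} (hf : Rat' f) : Rat' (-f) := by
  obtain ⟨p, hp, hpf⟩ := hf
  refine ⟨p, hp, ?_⟩
  rw [map_neg, Function.support_neg]
  exact hpf

lemma Rat'.sub {f g : ℤ → ℤ} (hf : Rat' f) (hg : Rat' g) : Rat' (f - g) := by
  rw [sub_eq_add_neg]; exact hf.add hg.neg

lemma Rat'.zero : Rat' 0 := ⟨1, by simp, by simp⟩

lemma Rat'.sum {ι : Type} (s : Finset ι) (f : ι → ℤ → ℤ) (h : ∀ i ∈ s, Rat' (f i)) :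
    Rat' (∑ i ∈ s, f i) := by
  classical
  induction s using Finset.induction_on with
  | empty => simpa using Rat'.zero
  | insert a s ha ih =>
    rw [Finset.sum_insert ha]
    exact (h a (by simp)).add (ih fun i hi => h i (by simp [hi]))

lemma Rat'.shift {f : ℤ → ℤ} (hf : Rat' f) (c : ℤ) : Rat' (fun n => f (n - c)) := by
  obtain ⟨p, hp, hpf⟩ := hf
  refine ⟨p, hp, ?_⟩
  have : Function.support (aeval Sh p (fun n => f (n - c))) ⊆
      (fun n => n + c) '' Function.support (aeval Sh p f) := by
    intro N hN
    refine ⟨N - c, ?_, by simp⟩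
    rw [Function.mem_support, aeval_Sh] at hN ⊢
    convert hN using 4
    ring
  exact (hpf.image _).subset this

/-- finitely supported sequences -/
def FinS : Submodule ℤ[X] (AEval' Sh) where
  carrier := {m | (Function.support ((AEval'.of Sh).symm m)).Finite}
  add_mem' {a b} ha hb := by
    change (Function.support _).Finite
    rw [map_add]
    exact (ha.union hb).subset (Function.support_add _ _)
  zero_mem' := by
    change (Function.support _).Finite
    simp
  smul_mem' c m hm := by
    change (Function.support _).Finite
    have : (AEval'.of Sh).symm (c • m) = aeval Sh c ((AEval'.of Sh).symm m) :=
      AEval.of_symm_smul Sh c m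
    rw [this]
    exact aeval_Sh_supp c hm

variable {k : Type} [Field k] {R : Type} [Ring R] [Algebra k R]
variable (𝒢 : ℤ → Submodule k R) [GradedAlgebra 𝒢] [∀ n, FiniteDimensional k (𝒢 n)]

lemma finF (hneg : ∀ n < 0, 𝒢 n = ⊥) {d : ℕ} (hcoh : CohStep 𝒢 d) :
    {h : ℤ → ℤ | ∃ I, InF 𝒢 d I ∧ h = Hf 𝒢 I}.Finite := by
  let ι : Type := Σ i : Fin (d + 1), Fin (Module.finrank k (𝒢 (i : ℕ)))
  let dg : ι → ℤ := fun i => (i.1 : ℕ)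
  have hdg : ∀ i, dg i ≤ d := fun i => by
    have := i.1.2
    simp only [dg]
    omega
  refine (finite_hilb 𝒢 hneg dg (2 * d)
    (fun v hv => syz_bound 𝒢 hneg hcoh v dg hdg hv)).subset ?_
  rintro _ ⟨I, hI, rfl⟩
  have hpr : ∀ n : ℤ, ∃ p : 𝒢 n →ₗ[k] ↥(𝒢 n ⊓ I.restrictScalars k),
      p ∘ₗ (Submodule.inclusion inf_le_left) = LinearMap.id := fun n =>
    LinearMap.exists_leftInverse_of_injective _
      (LinearMap.ker_eq_bot.2 (Submodule.inclusion_injective _))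
  choose p hp using hpr
  let b := fun n : ℤ => Module.finBasis k (𝒢 n)
  let v : ι → R := fun i => p (i.1 : ℕ) (b (i.1 : ℕ) i.2)
  refine ⟨v, fun i => (p _ (b _ i.2)).2.1, ?_⟩
  congr 1
  apply le_antisymm
  · obtain ⟨κ, _, u, du, hdu, hu, rfl⟩ := hI
    refine Submodule.span_le.2 ?_
    rintro _ ⟨i, rfl⟩
    by_cases h0 : du i < 0
    · have := hu i
      rw [hneg _ h0, Submodule.mem_bot] at this
      rw [this]; exact Submodule.zero_mem _
    · obtain ⟨n, hn⟩ := Int.eq_ofNat_of_zero_le (not_lt.1 h0)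
      have hnd : n < d + 1 := by have := hdu i; omega
      have hun : u i ∈ 𝒢 n := hn ▸ hu i
      have h1 := LinearMap.congr_fun (hp n) ⟨u i, hun, self_mem_idl u i⟩
      have h2 : ((p n ⟨u i, hun⟩ : ↥(𝒢 n ⊓ (idl u).restrictScalars k)) : R) = u i :=
        congrArg Subtype.val h1
      rw [← h2, ← (b n).sum_repr ⟨u i, hun⟩, map_sum]
      simp only [map_smul]
      rw [Submodule.coe_sum]
      refine Submodule.sum_mem _ fun j _ => ?_
      have h3 : v ⟨⟨n, hnd⟩, j⟩ ∈ idl v := self_mem_idl v _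
      exact Submodule.smul_mem ((idl v).restrictScalars k) _ h3
  · refine Submodule.span_le.2 ?_
    rintro _ ⟨i, rfl⟩
    exact (p _ (b _ i.2)).2.2

lemma top_InF (d : ℕ) : InF 𝒢 d ⊤ := by
  refine ⟨Unit, inferInstance, fun _ => 1, fun _ => 0, fun _ => by simp,
    fun _ => SetLike.GradedOne.one_mem, ?_⟩
  rw [eq_top_iff]
  intro r _
  rw [mem_idl]
  exact ⟨fun _ => r, by simp⟩

lemma rat_InF (hneg : ∀ n < 0, 𝒢 n = ⊥) (h0 : 𝒢 0 = Submodule.span k {1}) {d : ℕ}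
    (hcoh : CohStep 𝒢 d) (A : Submodule Rᵐᵒᵖ R) (hAF : InF 𝒢 d A) (hA : ∀ n ≠ 0, ∀ r ∈ 𝒢 n, r ∈ A)
    (hA0 : ∀ r ∈ 𝒢 0, r ∈ A → r = 0) (I : Submodule Rᵐᵒᵖ R) (hI : InF 𝒢 d I) :
    Rat' (Hf 𝒢 I) := by
  set o := AEval'.of Sh with ho
  set W : Submodule ℤ[X] (AEval' Sh) :=
    Submodule.span ℤ[X] (o '' {h : ℤ → ℤ | ∃ I, InF 𝒢 d I ∧ h = Hf 𝒢 I}) with hW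
  have hWfg : W.FG := Submodule.fg_span ((finF 𝒢 hneg hcoh).image _)
  have hmem : ∀ I, InF 𝒢 d I → o (Hf 𝒢 I) ∈ W := fun I hI =>
    Submodule.subset_span ⟨_, ⟨I, hI, rfl⟩, rfl⟩
  have key : ∀ I, InF 𝒢 d I → o (Hf 𝒢 I) ∈ FinS ⊔ (Ideal.span {(X : ℤ[X])}) • W := by
    refine fam_induction 𝒢 hneg hcoh _ ?_ ?_
    · have : Hf 𝒢 (⊥ : Submodule Rᵐᵒᵖ R) = 0 := by
        ext n
        unfold Hf
        rw [Submodule.restrictScalars_bot, inf_bot_eq, finrank_bot]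
        rfl
      rw [this, map_zero]
      exact Submodule.zero_mem _
    · intro I J x dx hI hJ hI0 hne hx hdx hIJ hcol ih
      rcases Nat.eq_zero_or_pos dx with rfl | hpos
      · -- degree zero: the ideal is everything
        have hItop : I = ⊤ := by
          simp only [Nat.cast_zero, h0] at hx
          obtain ⟨c, rfl⟩ := Submodule.mem_span_singleton.1 hx
          by_cases hc : c = 0
          · subst hc
            simp at hIJ
            exact absurd hIJ.symm hne
          · rw [eq_top_iff]
            intro r _
            rw [hIJ]
            refine (le_sup_right : _ ≤ J ⊔ Submodule.span Rᵐᵒᵖ {c • (1 : R)}) ?_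
            refine Submodule.mem_span_singleton.2 ⟨op (c⁻¹ • r), ?_⟩
            rw [op_smul_eq_mul]
            simp [hc]
        subst hItop
        have hAne : A ≠ ⊤ := by
          rintro rfl
          have h1 : (1 : R) = 0 := hA0 1 SetLike.GradedOne.one_mem trivial
          apply hI0
          rw [eq_bot_iff]
          intro r _
          have : r = 0 := by rw [← mul_one r, h1, mul_zero]
          rw [this]; exact Submodule.zero_mem _
        have h1 := ih A hAF le_top hAne
        have h2 : Hf 𝒢 ⊤ = Hf 𝒢 A + (Hf 𝒢 ⊤ - Hf 𝒢 A) := by ring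
        rw [h2, map_add]
        refine Submodule.add_mem _ h1 ((le_sup_left : FinS ≤ _) ?_)
        change (Function.support ((AEval'.of Sh).symm (o _))).Finite
        rw [ho, LinearEquiv.symm_apply_apply]
        refine (Set.finite_singleton (0 : ℤ)).subset ?_
        intro n hn
        by_contra hn0
        apply hn
        have : 𝒢 n ⊓ (⊤ : Submodule Rᵐᵒᵖ R).restrictScalars k = 𝒢 n ⊓ A.restrictScalars k := by
          simp only [Submodule.restrictScalars_top, inf_top_eq]
          exact (inf_eq_left.2 fun r hr => hA n hn0 r hr).symm
        rw [Pi.sub_apply]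
        unfold Hf
        rw [this, sub_self]
      · have h1 := ih J hJ (hIJ ▸ le_sup_left) hne
        have h2 : Hf 𝒢 I = Hf 𝒢 J + (Sh ^ dx) (Hf 𝒢 ⊤ - Hf 𝒢 (colon R x J)) := by
          ext n
          rw [hIJ, Hf_step 𝒢 J (hJ.hom 𝒢) x dx hx n, Pi.add_apply, Sh_pow_apply]
          rfl
        rw [h2, map_add]
        refine Submodule.add_mem _ h1 ((le_sup_right : _ ≤ FinS ⊔ _) ?_)
        have h3 : o ((Sh ^ dx) (Hf 𝒢 ⊤ - Hf 𝒢 (colon R x J))) =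
            (X ^ dx : ℤ[X]) • o (Hf 𝒢 ⊤ - Hf 𝒢 (colon R x J)) :=
          (AEval'.X_pow_smul_of Sh _ dx).symm
        rw [h3]
        refine Submodule.smul_mem_smul ?_ ?_
        · exact Ideal.mem_span_singleton.2 (dvd_pow_self X (by omega))
        · rw [map_sub]
          exact Submodule.sub_mem _ (hmem _ (top_InF 𝒢 d)) (hmem _ hcol)
  have hle : W ≤ FinS ⊔ (Ideal.span {(X : ℤ[X])}) • W := by
    rw [hW, Submodule.span_le]
    rintro _ ⟨_, ⟨I, hI, rfl⟩, rfl⟩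
    exact key I hI
  obtain ⟨q, hq, hqW⟩ := Submodule.exists_sub_one_mem_and_smul_le_of_fg_of_le_sup hWfg le_rfl hle
  refine ⟨q, ?_, ?_⟩
  · obtain ⟨c, hc⟩ := Ideal.mem_span_singleton.1 hq
    have := congrArg (fun p => coeff p 0) hc
    simp [coeff_sub] at this
    linarith
  · have h1 : q • o (Hf 𝒢 I) ∈ FinS := hqW (Submodule.smul_mem_pointwise_smul _ _ _ (hmem I hI))
    have h2 : (AEval'.of Sh).symm (q • o (Hf 𝒢 I)) = aeval Sh q (Hf 𝒢 I) := by
      have : (AEval'.of Sh).symm (q • o (Hf 𝒢 I)) = aeval Sh q ((AEval'.of Sh).symm (o (Hf 𝒢 I))) :=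
        AEval.of_symm_smul Sh q _
      rw [this, ho, LinearEquiv.symm_apply_apply]
    rw [← h2]
    exact h1

end Rationality

section KInduction

open Polynomial Module

variable {k : Type} [Field k] {R : Type} [Ring R] [Algebra k R]

/-- the map of free modules given by a matrix -/
def Kmap (k : Type) [Field k] {R : Type} [Ring R] [Algebra k R] {κ ι : Type} [Fintype κ]
    (h : κ → ι → R) : (κ → R) →ₗ[k] (ι → R) :=
  LinearMap.pi fun i => phi k (fun j => h j i)

lemma Kmap_apply {κ ι : Type} [Fintype κ] (h : κ → ι → R) (b : κ → R) (i : ι) :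
    Kmap k h b i = ∑ j, h j i * b j := by
  simp [Kmap, phi_apply]

/-- extension by zero in the first coordinate -/
def cons0 (k : Type) [Field k] (R : Type) [Ring R] [Algebra k R] (t : ℕ) :
    (Fin t → R) →ₗ[k] (Fin (t + 1) → R) where
  toFun a := Fin.cons 0 a
  map_add' a b := by
    ext i
    refine Fin.cases ?_ (fun i => ?_) i <;> simp
  map_smul' c a := by
    ext i
    refine Fin.cases ?_ (fun i => ?_) i <;> simp

lemma cons0_inj (t : ℕ) : Function.Injective (cons0 k R t) := by
  intro a b hab
  ext i
  have := congrFun hab i.succ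
  simpa [cons0] using this

variable (𝒢 : ℤ → Submodule k R) [GradedAlgebra 𝒢] [∀ n, FiniteDimensional k (𝒢 n)]

lemma syz_sum {κ lam : Type} [Fintype κ] [Fintype lam] (x : κ → R) (s : lam → κ → R)
    (c : lam → R) : ∑ j, x j * ∑ l, s l j * c l = ∑ l, (∑ j, x j * s l j) * c l := by
  simp_rw [Finset.mul_sum, Finset.sum_mul, ← mul_assoc]
  exact Finset.sum_comm

lemma rat_K (hneg : ∀ n < 0, 𝒢 n = ⊥) (h0 : 𝒢 0 = Submodule.span k {1}) {d0 : ℕ}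
    (hcoh : ∀ d, d0 ≤ d → CohStep 𝒢 d)
    (A : Submodule Rᵐᵒᵖ R) (hAF : ∀ d, d0 ≤ d → InF 𝒢 d A) (hA : ∀ n ≠ 0, ∀ r ∈ 𝒢 n, r ∈ A)
    (hA0 : ∀ r ∈ 𝒢 0, r ∈ A → r = 0) (t : ℕ) :
    ∀ (dg : Fin t → ℤ) (κ : Type) [Fintype κ] (h : κ → Fin t → R) (e : κ → ℤ),
      (∀ j i, h j i ∈ 𝒢 (e j - dg i)) →
      Rat' (fun n => (Module.finrank k ↥(Egr 𝒢 dg n ⊓ LinearMap.range (Kmap k h)) : ℤ)) := by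
  induction t with
  | zero =>
    intro dg κ _ h e hh
    have : (fun n => (Module.finrank k ↥(Egr 𝒢 dg n ⊓ LinearMap.range (Kmap k h)) : ℤ)) = 0 := by
      ext n
      simp
      exact Subsingleton.elim _ _
    rw [this]
    exact Rat'.zero
  | succ t ih =>
    intro dg κ _ h e hh
    obtain ⟨d, hd0, hd⟩ : ∃ d : ℕ, d0 ≤ d ∧ ∀ j, e j - dg 0 ≤ d := by
      refine ⟨d0 + ∑ j, (e j - dg 0).toNat, by omega, fun j => ?_⟩
      have h1 : (e j - dg 0).toNat ≤ ∑ j, (e j - dg 0).toNat :=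
        Finset.single_le_sum (f := fun j => (e j - dg 0).toNat) (fun _ _ => Nat.zero_le _)
          (Finset.mem_univ j)
      have h2 := Int.self_le_toNat (e j - dg 0)
      push_cast
      have h3 : ((e j - dg 0).toNat : ℤ) ≤ ((∑ j, (e j - dg 0).toNat : ℕ) : ℤ) := by
        exact_mod_cast h1
      push_cast at h3
      omega
    obtain ⟨lam, _, s, e1, -, hs, hs0, hsg⟩ := syz_bound 𝒢 hneg (hcoh d hd0)
      (fun j => h j 0) (fun j => e j - dg 0) hd (fun j => hh j 0)
    let h1 : lam → Fin t → R := fun l i => ∑ j, h j i.succ * s l j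
    have hr1 := ih (fun i => dg i.succ) lam h1 (fun l => e1 l + dg 0) (by
      intro l i
      exact Submodule.sum_mem _ fun j _ => mul_mem_gr 𝒢 (hh j i.succ) (hs l j) (by ring))
    have hr2 := (rat_InF 𝒢 hneg h0 (hcoh d hd0) A (hAF d hd0) hA hA0 (idl fun j => h j 0)
      ⟨κ, inferInstance, _, _, hd, fun j => hh j 0, rfl⟩).shift (dg 0)
    have hmap : ∀ n, (Egr 𝒢 dg n ⊓ LinearMap.range (Kmap k h)).map
        (LinearMap.proj 0 : (Fin (t + 1) → R) →ₗ[k] R) =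
        𝒢 (n - dg 0) ⊓ (idl fun j => h j 0).restrictScalars k := by
      intro n
      ext r
      constructor
      · rintro ⟨_, ⟨hE, b, rfl⟩, rfl⟩
        refine ⟨hE 0, ?_⟩
        exact (mem_idl _ _).2 ⟨b, Kmap_apply h b 0⟩
      · rintro ⟨hr, hri⟩
        obtain ⟨a, ha, rfl⟩ := hom_coeff 𝒢 (fun j => h j 0) (fun j => e j - dg 0)
          (fun j => hh j 0) hr hri
        refine ⟨Kmap k h a, ⟨fun i => ?_, a, rfl⟩, Kmap_apply h a 0⟩
        rw [Kmap_apply]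
        exact Submodule.sum_mem _ fun j _ => mul_mem_gr 𝒢 (hh j i) (ha j) (by ring)
    have hker : ∀ n, (Egr 𝒢 dg n ⊓ LinearMap.range (Kmap k h)) ⊓
        LinearMap.ker (LinearMap.proj 0 : (Fin (t + 1) → R) →ₗ[k] R) =
        (Egr 𝒢 (fun i => dg i.succ) n ⊓ LinearMap.range (Kmap k h1)).map (cons0 k R t) := by
      intro n
      ext v
      constructor
      · rintro ⟨⟨hE, b, rfl⟩, hv⟩
        have hv0 : Kmap k h b 0 = 0 := hv
        rw [Kmap_apply] at hv0
        obtain ⟨c, hc⟩ := hsg b hv0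
        have hk : ∀ i : Fin t, Kmap k h b i.succ = Kmap k h1 c i := by
          intro i
          rw [Kmap_apply, Kmap_apply]
          simp_rw [hc]
          exact syz_sum _ _ _
        refine ⟨Kmap k h1 c, ⟨fun i => hk i ▸ hE i.succ, c, rfl⟩, ?_⟩
        ext i
        refine Fin.cases ?_ (fun i => ?_) i
        · exact hv.symm
        · rw [hk i]; simp [cons0]
      · rintro ⟨_, ⟨hE, c, rfl⟩, rfl⟩
        refine ⟨⟨fun i => ?_, fun j => ∑ l, s l j * c l, ?_⟩, ?_⟩
        · refine Fin.cases ?_ (fun i => ?_) i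
          · simp [cons0]
          · simpa [cons0] using hE i
        · ext i
          refine Fin.cases ?_ (fun i => ?_) i
          · rw [Kmap_apply, syz_sum]
            simp [hs0, cons0]
          · rw [Kmap_apply, syz_sum]
            simp [cons0, Kmap_apply, h1]
        · simp [cons0]
    have hfin : (fun n => (Module.finrank k ↥(Egr 𝒢 dg n ⊓ LinearMap.range (Kmap k h)) : ℤ)) =
        (fun n => Hf 𝒢 (idl fun j => h j 0) (n - dg 0)) + (fun n => (Module.finrank k
          ↥(Egr 𝒢 (fun i => dg i.succ) n ⊓ LinearMap.range (Kmap k h1)) : ℤ)) := by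
      ext n
      rw [Pi.add_apply, ← finrank_map_add (LinearMap.proj 0 : (Fin (t + 1) → R) →ₗ[k] R),
        hmap n, hker n]
      push_cast
      congr 2
      exact (Submodule.equivMapOfInjective _ (cons0_inj t) _).finrank_eq.symm
    rw [hfin]
    exact hr2.add hr1

end KInduction

section ModulePart

open Polynomial Module

variable {k : Type} [Field k] {R : Type} [Ring R] [Algebra k R]
variable {M : Type} [AddCommGroup M] [Module Rᵐᵒᵖ M] [Module k M] [IsScalarTower k Rᵐᵒᵖ M]

/-- the presentation map -/
def bmap (k : Type) [Field k] {R : Type} [Ring R] [Algebra k R]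
    {M : Type} [AddCommGroup M] [Module Rᵐᵒᵖ M] [Module k M] [IsScalarTower k Rᵐᵒᵖ M]
    {t : ℕ} (b : Fin t → M) : (Fin t → R) →ₗ[k] M where
  toFun a := ∑ i, op (a i) • b i
  map_add' a a2 := by
    simp [add_smul, Finset.sum_add_distrib]
  map_smul' c a := by
    simp [Finset.smul_sum]

lemma bmap_apply {t : ℕ} (b : Fin t → M) (a : Fin t → R) :
    bmap k b a = ∑ i, op (a i) • b i := rfl

variable (𝒢 : ℤ → Submodule k R) [GradedAlgebra 𝒢]

lemma decomp_smul (ℳ : ℤ → Submodule k M) [DirectSum.Decomposition ℳ]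
    (hact : ∀ i j, ∀ r ∈ 𝒢 i, ∀ x ∈ ℳ j, op r • x ∈ ℳ (j + i)) (r : R) {d : ℤ} {x : M}
    (hx : x ∈ ℳ d) (n : ℤ) :
    (DirectSum.decompose ℳ (op r • x) n : M) = op (cp 𝒢 (n - d) r) • x := by
  induction r using DirectSum.Decomposition.inductionOn 𝒢 with
  | zero => simp
  | @homogeneous i m =>
    have h1 := hact i d m m.2 x hx
    by_cases hn : d + i = n
    · subst hn
      rw [DirectSum.decompose_of_mem_same ℳ h1, add_sub_cancel_left, cp_same 𝒢 m.2]
    · rw [DirectSum.decompose_of_mem_ne ℳ h1 hn, cp_ne 𝒢 m.2 (by omega)]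
      simp
  | add m m2 h1 h2 =>
    simp only [op_add, add_smul, DirectSum.decompose_add, DirectSum.add_apply, Submodule.coe_add,
      map_add, h1, h2]

variable [∀ n, FiniteDimensional k (𝒢 n)]

lemma rat_mod (hneg : ∀ n < 0, 𝒢 n = ⊥) (h0 : 𝒢 0 = Submodule.span k {1}) {d0 : ℕ}
    (hcoh : ∀ d, d0 ≤ d → CohStep 𝒢 d)
    (A : Submodule Rᵐᵒᵖ R) (hAF : ∀ d, d0 ≤ d → InF 𝒢 d A) (hA : ∀ n ≠ 0, ∀ r ∈ 𝒢 n, r ∈ A)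
    (hA0 : ∀ r ∈ 𝒢 0, r ∈ A → r = 0)
    (ℳ : ℤ → Submodule k M) (hInternal : DirectSum.IsInternal ℳ)
    (hact : ∀ i j, ∀ r ∈ 𝒢 i, ∀ x ∈ ℳ j, op r • x ∈ ℳ (j + i))
    {t : ℕ} (b : Fin t → M) (db : Fin t → ℤ) (hb : ∀ i, b i ∈ ℳ (db i))
    (hspan : Submodule.span Rᵐᵒᵖ (Set.range b) = ⊤) {m : ℕ} (h : Fin m → Fin t → R)
    (e : Fin m → ℤ) (hh : ∀ j i, h j i ∈ 𝒢 (e j - db i)) (hsol : SolSpanBy R M b h) :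
    Rat' (fun n => (Module.finrank k (ℳ n) : ℤ)) := by
  letI := hInternal.chooseDecomposition
  have hmap : ∀ n, (Egr 𝒢 db n).map (bmap k b) = ℳ n := by
    intro n
    ext x
    constructor
    · rintro ⟨a, ha, rfl⟩
      rw [bmap_apply]
      refine Submodule.sum_mem _ fun i _ => ?_
      have := hact _ _ _ (ha i) _ (hb i)
      rwa [add_sub_cancel] at this
    · intro hx
      have hx1 : x ∈ Submodule.span Rᵐᵒᵖ (Set.range b) := hspan ▸ Submodule.mem_top
      obtain ⟨c, hc⟩ := (Submodule.mem_span_range_iff_exists_fun _).1 hx1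
      refine ⟨fun i => cp 𝒢 (n - db i) (unop (c i)), fun i => cp_mem _ _ _, ?_⟩
      rw [bmap_apply, ← DirectSum.decompose_of_mem_same ℳ hx, ← hc, DirectSum.decompose_sum,
        DirectSum.sum_apply, Submodule.coe_sum]
      refine Finset.sum_congr rfl fun i _ => ?_
      rw [← decomp_smul 𝒢 ℳ hact (unop (c i)) (hb i) n, op_unop]
  have hker : LinearMap.ker (bmap k b) = LinearMap.range (Kmap k h) := by
    ext v
    rw [LinearMap.mem_ker, bmap_apply]
    constructor
    · intro hv
      obtain ⟨c, hc⟩ := (Submodule.mem_span_range_iff_exists_fun _).1 (hsol.2 v hv)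
      refine ⟨fun j => unop (c j), ?_⟩
      ext i
      rw [Kmap_apply, ← hc, Finset.sum_apply]
      rfl
    · rintro ⟨c, rfl⟩
      simp_rw [Kmap_apply, Finset.op_sum, op_mul, Finset.sum_smul, mul_smul]
      rw [Finset.sum_comm]
      refine Finset.sum_eq_zero fun j _ => ?_
      rw [← Finset.smul_sum]
      have : ∑ i, op (h j i) • b i = 0 := hsol.1 j
      rw [this, smul_zero]
  have hK := rat_K 𝒢 hneg h0 hcoh A hAF hA hA0 t db (Fin m) h e hh
  have hT := rat_InF 𝒢 hneg h0 (hcoh d0 le_rfl) A (hAF d0 le_rfl) hA hA0 ⊤ (top_InF 𝒢 d0)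
  have hS := Rat'.sum Finset.univ (fun i : Fin t => fun n => Hf 𝒢 ⊤ (n - db i))
    fun i _ => hT.shift (db i)
  have hfin : (fun n => (Module.finrank k (ℳ n) : ℤ)) =
      (∑ i : Fin t, fun n => Hf 𝒢 ⊤ (n - db i)) -
      (fun n => (Module.finrank k ↥(Egr 𝒢 db n ⊓ LinearMap.range (Kmap k h)) : ℤ)) := by
    ext n
    have h1 := finrank_map_add (bmap k b) (Egr 𝒢 db n)
    rw [hmap n, hker, Egr_finrank] at h1
    rw [Pi.sub_apply, Finset.sum_apply]
    unfold Hf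
    have htop : ∀ i, 𝒢 (n - db i) ⊓ (⊤ : Submodule Rᵐᵒᵖ R).restrictScalars k = 𝒢 (n - db i) :=
      fun i => by rw [Submodule.restrictScalars_top, inf_top_eq]
    have hsum : ∑ i, (Module.finrank k
        ↥(𝒢 (n - db i) ⊓ (⊤ : Submodule Rᵐᵒᵖ R).restrictScalars k) : ℤ) =
        ∑ i, (Module.finrank k ↥(𝒢 (n - db i)) : ℤ) :=
      Finset.sum_congr rfl fun i _ => by rw [htop i]
    rw [eq_sub_iff_add_eq, hsum]
    exact_mod_cast h1
  rw [hfin]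
  exact hS.sub hK

end ModulePart

section Conversion

open Polynomial Module

variable {k : Type} [Field k] {R : Type} [Ring R] [Algebra k R] (𝒜 : ℕ → Submodule k R)

lemma grZ_nat (n : ℕ) : grZ k R 𝒜 n = 𝒜 n := by simp [grZ]

lemma grZ_neg (n : ℤ) (hn : n < 0) : grZ k R 𝒜 n = ⊥ := by
  simp [grZ, not_le.2 hn]

lemma grZ_internal (h : DirectSum.IsInternal 𝒜) : DirectSum.IsInternal (grZ k R 𝒜) := by
  apply DirectSum.isInternal_submodule_of_iSupIndep_of_iSup_eq_top
  · rw [← iSupIndep_ne_bot]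
    have h0 : ∀ i : {i // grZ k R 𝒜 i ≠ ⊥}, 0 ≤ i.1 := fun i => by
      by_contra hlt
      exact i.2 (grZ_neg 𝒜 _ (not_le.1 hlt))
    have := h.submodule_iSupIndep.comp (f := fun i : {i // grZ k R 𝒜 i ≠ ⊥} => i.1.toNat) (by
      intro i j hij
      have hi := h0 i
      have hj := h0 j
      apply Subtype.ext
      simp only at hij
      omega)
    convert this using 2 with i
    simp only [grZ, h0 i, if_true]
    rfl
  · rw [eq_top_iff, ← h.submodule_iSup_eq_top]
    exact iSup_le fun n => (grZ_nat 𝒜 n).symm.le.trans (le_iSup (grZ k R 𝒜) (n : ℤ))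

/-- the integer graded algebra structure -/
noncomputable def grZ_alg (h : IsConnAlg k R 𝒜) : GradedAlgebra (grZ k R 𝒜) :=
  { (grZ_internal 𝒜 h.2.1).chooseDecomposition with
    one_mem := by
      have : grZ k R 𝒜 0 = 𝒜 0 := grZ_nat 𝒜 0
      rw [this, h.2.2]
      exact Submodule.mem_span_singleton_self 1
    mul_mem := by
      intro i j x y hx hy
      by_cases hi : i < 0
      · rw [grZ_neg 𝒜 i hi, Submodule.mem_bot] at hx
        rw [hx, zero_mul]; exact Submodule.zero_mem _
      by_cases hj : j < 0
      · rw [grZ_neg 𝒜 j hj, Submodule.mem_bot] at hy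
        rw [hy, mul_zero]; exact Submodule.zero_mem _
      obtain ⟨a, rfl⟩ := Int.eq_ofNat_of_zero_le (not_lt.1 hi)
      obtain ⟨c, rfl⟩ := Int.eq_ofNat_of_zero_le (not_lt.1 hj)
      rw [grZ_nat] at hx hy
      rw [← Int.natCast_add, grZ_nat]
      exact h.1 a c x hx y hy }

lemma InF_iff (d : ℕ) (I : Submodule Rᵐᵒᵖ R) : InF (grZ k R 𝒜) d I ↔ FinGenLE k R 𝒜 I d := by
  constructor
  · rintro ⟨ι, _, v, dv, hd, hv, rfl⟩
    let g := (Fintype.equivFin ι).symm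
    refine ⟨Fintype.card ι, fun i => v (g i), fun i => (dv (g i)).toNat, fun i => ?_, fun i => ?_, ?_⟩
    · have := hd (g i)
      change (dv (g i)).toNat ≤ d
      omega
    · have := hv (g i)
      change v (g i) ∈ 𝒜 (dv (g i)).toNat
      by_cases hi : dv (g i) < 0
      · rw [grZ_neg 𝒜 _ hi, Submodule.mem_bot] at this
        rw [this]; exact Submodule.zero_mem _
      · simpa [grZ, not_lt.1 hi] using this
    · unfold idl
      congr 1
      exact g.surjective.range_comp v
  · rintro ⟨n, x, dx, hd, hx, rfl⟩
    exact ⟨Fin n, inferInstance, x, fun i => dx i, fun i => Int.ofNat_le.2 (hd i),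
      fun i => (grZ_nat 𝒜 (dx i)).symm ▸ hx i, rfl⟩

lemma coh_of (d : ℕ) (h : IsCohFam k R 𝒜 {I : Submodule Rᵐᵒᵖ R | FinGenLE k R 𝒜 I d}) :
    CohStep (grZ k R 𝒜) d ∧ InF (grZ k R 𝒜) d (aug k R 𝒜) := by
  obtain ⟨-, -, haug, hst⟩ := h
  refine ⟨fun I hI hI0 => ?_, (InF_iff 𝒜 d _).2 haug⟩
  obtain ⟨J, hJ, hne, x, ⟨dx, hx⟩, -, hIJ, -, hcol⟩ := hst I ((InF_iff 𝒜 d _).1 hI) hI0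
  exact ⟨J, (InF_iff 𝒜 d _).2 hJ, hne, x, dx, (grZ_nat 𝒜 dx).symm ▸ hx, hIJ,
    (InF_iff 𝒜 d _).2 hcol⟩

lemma aug_mem (n : ℤ) (hn : n ≠ 0) (r : R) (hr : r ∈ grZ k R 𝒜 n) : r ∈ aug k R 𝒜 := by
  by_cases h : n < 0
  · rw [grZ_neg 𝒜 n h, Submodule.mem_bot] at hr
    rw [hr]; exact Submodule.zero_mem _
  · obtain ⟨a, rfl⟩ := Int.eq_ofNat_of_zero_le (not_lt.1 h)
    rw [grZ_nat] at hr
    refine Submodule.subset_span ?_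
    simp only [Set.mem_iUnion]
    exact ⟨a, by omega, hr⟩

lemma aug_zero [GradedAlgebra (grZ k R 𝒜)] (r : R) (hr : r ∈ grZ k R 𝒜 0)
    (hra : r ∈ aug k R 𝒜) : r = 0 := by
  rw [← cp_same _ hr]
  clear hr
  unfold aug at hra
  induction hra using Submodule.span_induction with
  | mem x hx =>
    simp only [Set.mem_iUnion] at hx
    obtain ⟨i, hi, hx⟩ := hx
    exact cp_ne _ (n := (i : ℤ)) ((grZ_nat 𝒜 i).symm ▸ hx) (by omega)
  | zero => simp
  | add x y _ _ hx hy => rw [map_add, hx, hy, add_zero]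
  | smul a x hx1 hx =>
    -- use that x is a sum of generators: reprove through components
    have key : ∀ y ∈ Submodule.span Rᵐᵒᵖ (⋃ i : ℕ, ⋃ _ : 1 ≤ i, ((𝒜 i : Set R))),
        ∀ c : R, cp (grZ k R 𝒜) 0 (y * c) = 0 := by
      intro y hy
      induction hy using Submodule.span_induction with
      | mem x hx =>
        intro c
        simp only [Set.mem_iUnion] at hx
        obtain ⟨i, hi, hx⟩ := hx
        rw [cp_mul_left _ (i := (i : ℤ)) ((grZ_nat 𝒜 i).symm ▸ hx)]
        have := cp_mem (grZ k R 𝒜) (0 - (i : ℤ)) c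
        rw [grZ_neg 𝒜 _ (by omega), Submodule.mem_bot] at this
        rw [this, mul_zero]
      | zero => simp
      | add x y _ _ hx hy => intro c; rw [add_mul, map_add, hx, hy, add_zero]
      | smul a x _ hx =>
        intro c
        have := hx (unop a * c)
        rw [← mul_assoc] at this
        exact this
    exact key x hx1 (unop a)

lemma ps_of_rat (f : ℕ → ℤ) (F : ℤ → ℤ) (hF : ∀ n : ℕ, F n = f n) (hneg : ∀ n < 0, F n = 0)
    (h : Rat' F) : ∃ p q : ℤ[X], q.coeff 0 = 1 ∧
      PowerSeries.mk (fun i => q.coeff i) * PowerSeries.mk f =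
      PowerSeries.mk (fun i => p.coeff i) := by
  obtain ⟨q, hq, hfin⟩ := h
  obtain ⟨B, hB⟩ : ∃ B : ℕ, ∀ n : ℕ, B ≤ n → aeval Sh q F n = 0 := by
    obtain ⟨b, hb⟩ := hfin.bddAbove
    refine ⟨b.toNat + 1, fun n hn => ?_⟩
    by_contra hne
    have := hb (Function.mem_support.2 hne)
    omega
  refine ⟨∑ i ∈ Finset.range B, C (aeval Sh q F i) * X ^ i, q, hq, ?_⟩
  ext n
  rw [PowerSeries.coeff_mul, PowerSeries.coeff_mk, finset_sum_coeff]
  have hr : ∑ i ∈ Finset.range B, (C (aeval Sh q F i) * X ^ i).coeff n = aeval Sh q F n := by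
    simp only [coeff_C_mul, coeff_X_pow, mul_ite, mul_one, mul_zero]
    rw [Finset.sum_ite_eq]
    split_ifs with hn
    · rfl
    · exact (hB n (by simpa using hn)).symm
  rw [hr, aeval_Sh]
  simp only [PowerSeries.coeff_mk]
  rw [Finset.Nat.sum_antidiagonal_eq_sum_range_succ (fun a c => q.coeff a * f c) n]
  have e1 : ∑ i ∈ Finset.range n.succ, q.coeff i * f (n - i) =
      ∑ i ∈ Finset.range (n.succ + (q.natDegree + 1)), q.coeff i * F (n - i) := by
    rw [← Finset.sum_subset (s₁ := Finset.range n.succ)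
      (Finset.range_subset_range.2 (Nat.le_add_right _ _))]
    · refine Finset.sum_congr rfl fun i hi => ?_
      have : i ≤ n := by simpa [Nat.lt_succ_iff] using hi
      rw [← hF, Nat.cast_sub this]
    · intro i _ hi
      rw [hneg, mul_zero]
      have : n < i := by simpa using hi
      omega
  rw [e1]
  symm
  refine Finset.sum_subset (Finset.range_subset_range.2 (Nat.le_add_left _ _)) ?_
  intro i _ hi
  rw [coeff_eq_zero_of_natDegree_lt, zero_mul]
  have : q.natDegree + 1 ≤ i := by simpa using hi
  omega

end Conversion

/-- every finitely presented graded module over a universally coherent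
algebra has a rational Hilbert series; in particular so does the algebra itself. -/
theorem statement_19 (k R : Type) [Field k] [Ring R] [Algebra k R]
    (𝒜 : ℕ → Submodule k R) (hconn : IsConnAlg k R 𝒜) (hlf : LocFin k R 𝒜)
    (hfga : FinGenAlg k R)
    (huc : ∃ d0 : ℕ, ∀ d : ℕ, d0 ≤ d →
      IsCohFam k R 𝒜 {I : Submodule Rᵐᵒᵖ R | FinGenLE k R 𝒜 I d}) :
    (∀ P : ModData k R, IsGradedMod k R P.carrier 𝒜 P.grading →
      ModFinPres k R P.carrier 𝒜 P.grading →
      ∃ (p : ℤ →₀ ℤ) (q : Polynomial ℤ), q.coeff 0 = 1 ∧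
        ∀ N : ℤ, ∑ i ∈ Finset.range (q.natDegree + 1),
          q.coeff i *
            (hilb k R P.carrier P.grading (⊤ : Submodule Rᵐᵒᵖ P.carrier) (N - i) : ℤ)
          = p N) ∧
    (∃ p q : Polynomial ℤ, q.coeff 0 = 1 ∧
      PowerSeries.mk (fun i => q.coeff i) *
        PowerSeries.mk (fun i => (hilbA k R 𝒜 i : ℤ)) =
      PowerSeries.mk (fun i => p.coeff i)) := by
  obtain ⟨d0, hd0⟩ := huc
  letI := grZ_alg 𝒜 hconn
  have hneg := grZ_neg 𝒜
  haveI hfd : ∀ n, FiniteDimensional k (grZ k R 𝒜 n) := by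
    intro n
    by_cases hn : n < 0
    · rw [grZ_neg 𝒜 n hn]; infer_instance
    · obtain ⟨a, rfl⟩ := Int.eq_ofNat_of_zero_le (not_lt.1 hn)
      rw [grZ_nat]; exact hlf a
  have h0 : grZ k R 𝒜 0 = Submodule.span k {1} := (grZ_nat 𝒜 0).trans hconn.2.2
  have hcoh : ∀ d, d0 ≤ d → CohStep (grZ k R 𝒜) d := fun d hd => (coh_of 𝒜 d (hd0 d hd)).1
  have hAF : ∀ d, d0 ≤ d → InF (grZ k R 𝒜) d (aug k R 𝒜) := fun d hd =>
    (coh_of 𝒜 d (hd0 d hd)).2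
  constructor
  · intro P hP hfp
    obtain ⟨t, b, db, hb, hspan, m, h, e, hh, hsol⟩ := hfp
    have hact : ∀ i j, ∀ r ∈ grZ k R 𝒜 i, ∀ x ∈ P.grading j, op r • x ∈ P.grading (j + i) := by
      intro i j r hr x hx
      by_cases hi : i < 0
      · rw [grZ_neg 𝒜 i hi, Submodule.mem_bot] at hr
        rw [hr, op_zero, zero_smul]; exact Submodule.zero_mem _
      · obtain ⟨a, rfl⟩ := Int.eq_ofNat_of_zero_le (not_lt.1 hi)
        rw [grZ_nat] at hr
        exact hP.1 a j r hr x hx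
    obtain ⟨q, hq, hfin⟩ := rat_mod (grZ k R 𝒜) hneg h0 hcoh (aug k R 𝒜) hAF (aug_mem 𝒜)
      (aug_zero 𝒜) P.grading hP.2 hact b db hb hspan h e hh hsol
    refine ⟨Finsupp.ofSupportFinite _ hfin, q, hq, fun N => ?_⟩
    have hhilb : ∀ n, hilb k R P.carrier P.grading (⊤ : Submodule Rᵐᵒᵖ P.carrier) n =
        Module.finrank k (P.grading n) := by
      intro n
      unfold hilb
      rw [Submodule.restrictScalars_top, inf_top_eq]
    rw [Finsupp.ofSupportFinite_coe, aeval_Sh]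
    exact Finset.sum_congr rfl fun i _ => by rw [hhilb]
  · have hT := rat_InF (grZ k R 𝒜) hneg h0 (hcoh d0 le_rfl) (aug k R 𝒜) (hAF d0 le_rfl)
      (aug_mem 𝒜) (aug_zero 𝒜) ⊤ (top_InF (grZ k R 𝒜) d0)
    refine ps_of_rat _ _ (fun n => ?_) (fun n hn => ?_) hT
    · unfold Hf hilbA
      rw [Submodule.restrictScalars_top, inf_top_eq, grZ_nat]
    · unfold Hf
      rw [Submodule.restrictScalars_top, inf_top_eq, grZ_neg 𝒜 n hn, finrank_bot]
      rfl

end NCG
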